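/- Let d ≥ 2 and let Σ₁ : U₁ → ℝ^d, …, Σ_d : U_d → ℝ^d be smooth immersions on compact sets U_j ⊆ ℝ^{d-1} whose unit normals satisfy |det(ν_{Σ₁}(x₁), …, ν_{Σ_d}(x_d))| ≥ ν for some ν > 0 and all x_j ∈ U_j. Then there exists r > 0 (depending on the Σ_j and ν) such that whenever each U_j has diameter at most r there is a finite constant C with ‖ ∏_{j=1}^d E_j g_j ‖_{L^2(ℝ^d)} ≤ C ∏_{j=1}^d ‖g_j‖_{L^{(2d-2)'}(U_j)} for all g_j ∈ L^{(2d-2)'}(U_j), where (2d−2)' = (2d−2)/(2d−3). -/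

import Mathlib

open MeasureTheory Metric Complex
open scoped InnerProductSpace ENNReal

/-- The extension operator associated with a parametrised hypersurface
`Σ : U → ℝ^d`, `U ⊆ ℝ^{d-1}`:  `Eg(ξ) = ∫_U g(x) e^{i ξ·Σ(x)} dx`. -/
noncomputable def extOp {n : ℕ} (U : Set (EuclideanSpace ℝ (Fin n)))
    (S : EuclideanSpace ℝ (Fin n) → EuclideanSpace ℝ (Fin (n + 1)))
    (g : EuclideanSpace ℝ (Fin n) → ℂ) (ξ : EuclideanSpace ℝ (Fin (n + 1))) : ℂ :=
  ∫ x in U, Complex.exp (Complex.I * (⟪ξ, S x⟫_ℝ : ℂ)) * g x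

theorem Finset.sum_transfer_eq_sum_path {A : Type*} [Fintype A] (n : ℕ) :
    ∀ (M : Fin n → A → A → ℝ≥0∞) (D : Fin (n + 1) → A → ℝ≥0∞),
      (∀ m y', D m.succ y' = ∑ y, D m.castSucc y * M m y y') →
      ∑ y, D (Fin.last n) y =
        ∑ Y : Fin (n + 1) → A, D 0 (Y 0) * ∏ m, M m (Y m.castSucc) (Y m.succ) := by
  induction n with
  | zero =>
    intro M D _
    rw [← (Equiv.funUnique (Fin 1) A).symm.sum_comp]
    simp
  | succ n ih =>
    intro M D hD
    have h := ih (fun m => M m.succ) (fun m => D m.succ) (fun m y' => by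
      rw [hD m.succ y']; rfl)
    rw [← Fin.succ_last, h, ← (Fin.consEquiv fun _ : Fin (n + 2) => A).sum_comp,
      Fintype.sum_prod_type_right]
    refine Finset.sum_congr rfl fun Y _ => ?_
    rw [hD, Finset.sum_mul]
    refine Finset.sum_congr rfl fun y _ => ?_
    simp [Fin.consEquiv, Fin.prod_univ_succ, mul_assoc]

theorem Fin.prod_prod_ne_castSucc_succ {M : Type*} [CommMonoid M] (k : ℕ)
    (b : Fin (k + 2) → M) :
    (∏ m : Fin (k + 1), ∏ j with j ≠ m.castSucc ∧ j ≠ m.succ, b j) *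
      ∏ i : Fin k, b i.castSucc.succ = ∏ j, b j ^ k := by
  have h1 : (∏ m : Fin (k + 1), ∏ j with j ≠ m.castSucc ∧ j ≠ m.succ, b j) =
      ∏ j, b j ^ (Finset.univ.filter fun m : Fin (k + 1) =>
        j ≠ m.castSucc ∧ j ≠ m.succ).card := by
    simp_rw [Finset.prod_filter]
    rw [Finset.prod_comm]
    refine Finset.prod_congr rfl fun j _ => ?_
    rw [← Finset.prod_filter, Finset.prod_const]
  have card1 (j : Fin (k + 1)) : (Finset.univ.filter fun m : Fin (k + 1) => j ≠ m).card = k := by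
    rw [Finset.filter_ne]; simp
  rw [h1, Fin.prod_univ_succ, Fin.prod_univ_succ (n := k + 1), Fin.prod_univ_castSucc,
    Fin.prod_univ_castSucc (n := k)]
  have e0 : (Finset.univ.filter fun m : Fin (k + 1) =>
        (0 : Fin (k + 2)) ≠ m.castSucc ∧ (0 : Fin (k + 2)) ≠ m.succ).card = k := by
    refine (congrArg Finset.card (Finset.filter_congr fun m _ => ?_)).trans (card1 0)
    simp only [ne_eq, Fin.ext_iff, Fin.val_zero, Fin.val_castSucc, Fin.val_succ]
    omega
  have el : (Finset.univ.filter fun m : Fin (k + 1) =>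
        (Fin.last k).succ ≠ m.castSucc ∧ (Fin.last k).succ ≠ m.succ).card = k := by
    refine (congrArg Finset.card (Finset.filter_congr fun m _ => ?_)).trans (card1 (Fin.last k))
    simp [Fin.ext_iff]; omega
  have ei (i : Fin k) : (Finset.univ.filter fun m : Fin (k + 1) =>
        i.castSucc.succ ≠ m.castSucc ∧ i.castSucc.succ ≠ m.succ).card + 1 = k := by
    have : (Finset.univ.filter fun m : Fin (k + 1) =>
        i.castSucc.succ ≠ m.castSucc ∧ i.castSucc.succ ≠ m.succ) =
        ({i.castSucc, i.succ} : Finset (Fin (k + 1)))ᶜ := by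
      ext m; simp [Fin.ext_iff]; omega
    rw [this, Finset.card_compl, Finset.card_pair (by simp [Fin.ext_iff])]
    have := i.2
    simp; omega
  rw [e0, el, mul_assoc, mul_right_comm (∏ i : Fin k, _), ← Finset.prod_mul_distrib]
  simp_rw [← pow_succ, ei]

theorem Finset.sum_path_le_card_mul_prod (k : ℕ) {A : Type*} [Fintype A] [DecidableEq A]
    (R : Set (Fin (k + 2) → A)) [DecidablePred (· ∈ R)] (a : Fin (k + 2) → A → ℝ≥0∞) (N : ℕ)
    (hN : ∀ P : Fin (k + 1) → Fin (k + 2) → A,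
      {Y : Fin (k + 2) → A | ∀ m : Fin (k + 1), ∃ X ∈ R, X m.castSucc = Y m.castSucc ∧
        X m.succ = Y m.succ ∧ ∀ j, j ≠ m.castSucc → j ≠ m.succ → X j = P m j}.ncard ≤ N)
    (M : Fin (k + 1) → A → A → ℝ≥0∞)
    (hM : ∀ m y y', M m y y' = ∑ X : Fin (k + 2) → A with
      X ∈ R ∧ X m.castSucc = y ∧ X m.succ = y',
        ∏ j with j ≠ m.castSucc ∧ j ≠ m.succ, a j (X j)) :
    ∑ Y : Fin (k + 2) → A, ∏ m, M m (Y m.castSucc) (Y m.succ) ≤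
      N * ∏ m : Fin (k + 1), ∏ j with j ≠ m.castSucc ∧ j ≠ m.succ, ∑ q, a j q := by
  let I (m : Fin (k + 1)) := {j : Fin (k + 2) // j ≠ m.castSucc ∧ j ≠ m.succ}
  let rest (p : (Fin (k + 2) → A) × (Fin (k + 1) → Fin (k + 2) → A)) :
    (m : Fin (k + 1)) → I m → A := fun m j => p.2 m j
  let W (c : (m : Fin (k + 1)) → I m → A) : ℝ≥0∞ := ∏ m, ∏ j : I m, a j (c m j)
  let V : Finset ((Fin (k + 2) → A) × (Fin (k + 1) → Fin (k + 2) → A)) :=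
    Finset.univ.filter fun p => ∀ m, p.2 m ∈ R ∧ p.2 m m.castSucc = p.1 m.castSucc ∧
      p.2 m m.succ = p.1 m.succ
  have hW : ∑ c, W c = ∏ m : Fin (k + 1), ∏ j with j ≠ m.castSucc ∧ j ≠ m.succ, ∑ q, a j q := by
    simp only [W]
    rw [← Fintype.piFinset_univ,
      ← Finset.prod_univ_sum (fun _ => Finset.univ) (fun m (c : I m → A) => ∏ j : I m, a j (c j))]
    refine Finset.prod_congr rfl fun m _ => ?_
    rw [← Fintype.piFinset_univ,
      ← Finset.prod_univ_sum (fun _ => Finset.univ) (fun (j : I m) (q : A) => a j q)]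
    exact (Finset.prod_subtype _ (by simp) fun j => ∑ q, a j q).symm
  have hZ : ∑ Y : Fin (k + 2) → A, ∏ m, M m (Y m.castSucc) (Y m.succ) =
      ∑ p ∈ V, W (rest p) := by
    rw [Finset.sum_filter, Fintype.sum_prod_type]
    refine Finset.sum_congr rfl fun Y _ => ?_
    simp_rw [hM, Finset.sum_filter]
    rw [Finset.prod_univ_sum, Fintype.piFinset_univ]
    refine Finset.sum_congr rfl fun X _ => ?_
    rw [Finset.prod_ite_zero]
    simp only [Finset.mem_univ, true_implies]
    refine if_congr Iff.rfl (Finset.prod_congr rfl fun m _ => ?_) rfl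
    exact Finset.prod_subtype _ (by simp) fun j => a j (X m j)
  rw [hZ, ← hW, ← Finset.sum_fiberwise V rest, Finset.mul_sum]
  refine Finset.sum_le_sum fun c _ => ?_
  rw [Finset.sum_congr rfl (g := fun _ => W c)
    (fun p hp => by rw [(Finset.mem_filter.1 hp).2]), Finset.sum_const, nsmul_eq_mul]
  gcongr
  rcases (V.filter fun p => rest p = c).eq_empty_or_nonempty with h | ⟨p₀, hp₀⟩
  · simp [h]
  refine le_trans ?_ (hN p₀.2)
  rw [Set.ncard_eq_toFinset_card']
  have hrest : ∀ p ∈ V.filter fun p => rest p = c, ∀ m j, j ≠ m.castSucc → j ≠ m.succ →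
      p.2 m j = p₀.2 m j := by
    intro p hp m j h1 h2
    have := (Finset.mem_filter.1 hp).2.trans (Finset.mem_filter.1 hp₀).2.symm
    exact congrFun (congrFun this m) ⟨j, h1, h2⟩
  refine Finset.card_le_card_of_injOn Prod.fst ?_ ?_
  · intro p hp
    have hV := (Finset.mem_filter.1 (Finset.mem_filter.1 hp).1).2
    rw [Set.coe_toFinset]
    exact fun m => ⟨p.2 m, (hV m).1, (hV m).2.1, (hV m).2.2, hrest p hp m⟩
  · intro p hp p' hp' hpp
    have hV := (Finset.mem_filter.1 (Finset.mem_filter.1 hp).1).2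
    have hV' := (Finset.mem_filter.1 (Finset.mem_filter.1 hp').1).2
    refine Prod.ext hpp (funext fun m => funext fun j => ?_)
    by_cases h1 : j = m.castSucc
    · rw [h1, (hV m).2.1, (hV' m).2.1, hpp]
    by_cases h2 : j = m.succ
    · rw [h2, (hV m).2.2, (hV' m).2.2, hpp]
    rw [hrest p hp m j h1 h2, hrest p' hp' m j h1 h2]

theorem Finset.sum_prod_rpow_le_of_path_card (k : ℕ) {A : Type*} [Fintype A] [DecidableEq A]
    (R : Set (Fin (k + 2) → A)) [DecidablePred (· ∈ R)] (a : Fin (k + 2) → A → ℝ≥0∞)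
    (ha : ∀ j q, a j q ≠ ∞) (N : ℕ)
    (hN : ∀ P : Fin (k + 1) → Fin (k + 2) → A,
      {Y : Fin (k + 2) → A | ∀ m : Fin (k + 1), ∃ X ∈ R, X m.castSucc = Y m.castSucc ∧
        X m.succ = Y m.succ ∧ ∀ j, j ≠ m.castSucc → j ≠ m.succ → X j = P m j}.ncard ≤ N) :
    ∑ X with X ∈ R, ∏ j, a j (X j) ^ ((k : ℝ) / (k + 1)) ≤
      (N : ℝ≥0∞) ^ (1 / ((k : ℝ) + 1)) * ∏ j, (∑ q, a j q) ^ ((k : ℝ) / (k + 1)) := by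
  let w (m : Fin (k + 1)) (X : Fin (k + 2) → A) : ℝ≥0∞ :=
    ∏ j with j ≠ m.castSucc ∧ j ≠ m.succ, a j (X j)
  let M (m : Fin (k + 1)) (y y' : A) : ℝ≥0∞ :=
    ∑ X : Fin (k + 2) → A with X ∈ R ∧ X m.castSucc = y ∧ X m.succ = y', w m X
  let D (i : Fin (k + 2)) : A → ℝ≥0∞ :=
    Fin.induction (motive := fun _ => A → ℝ≥0∞) (fun _ => 1)
      (fun m Dm y' => ∑ y, Dm y * M m y y') i
  have hD0 : D 0 = fun _ => 1 := rfl
  have hD (m : Fin (k + 1)) (y' : A) : D m.succ y' = ∑ y, D m.castSucc y * M m y y' := by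
    simp [D, Fin.induction_succ]
  have hD' (m : Fin (k + 1)) (y' : A) : D m.succ y' =
      ∑ X : Fin (k + 2) → A with X ∈ R ∧ X m.succ = y', D m.castSucc (X m.castSucc) * w m X := by
    rw [hD, ← Finset.sum_fiberwise _ fun X : Fin (k + 2) → A => X m.castSucc]
    refine Finset.sum_congr rfl fun y _ => ?_
    simp only [M, Finset.mul_sum, Finset.filter_filter]
    refine Finset.sum_congr (Finset.filter_congr fun X _ => by tauto) fun X hX => ?_
    rw [(Finset.mem_filter.1 hX).2.2]
  have hDtop (i : Fin (k + 2)) : ∀ y, D i y ≠ ∞ := by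
    induction i using Fin.induction with
    | zero => simp [hD0]
    | succ m ih =>
      intro y'
      rw [hD']
      exact ENNReal.sum_ne_top.2 fun X _ =>
        ENNReal.mul_ne_top (ih _) (ENNReal.prod_ne_top fun j _ => ha _ _)
  let t (m : Fin (k + 1)) : A → ℝ≥0∞ := Fin.lastCases (motive := fun _ => A → ℝ≥0∞)
    (fun _ => 1) (fun i y => a i.castSucc.succ y / D i.castSucc.succ y) m
  have htl : t (Fin.last k) = fun _ => 1 := by simp [t]
  have htc (i : Fin k) : t i.castSucc =
    fun y => a i.castSucc.succ y / D i.castSucc.succ y := by simp [t]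
  let Q (m : Fin (k + 1)) (X : Fin (k + 2) → A) : ℝ≥0∞ :=
    if X ∈ R then D m.castSucc (X m.castSucc) * w m X * t m (X m.succ) else 0
  have hQ (m : Fin (k + 1)) : ∑ X, Q m X = ∑ y, D m.succ y * t m y := by
    simp only [Q]
    rw [← Finset.sum_filter, ← Finset.sum_fiberwise _ fun X : Fin (k + 2) → A => X m.succ]
    refine Finset.sum_congr rfl fun y _ => ?_
    rw [hD', Finset.sum_mul, Finset.filter_filter]
    refine Finset.sum_congr rfl fun X hX => ?_
    rw [(Finset.mem_filter.1 hX).2.2]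
  have hQc (i : Fin k) : ∑ X, Q i.castSucc X ≤ ∑ q, a i.castSucc.succ q := by
    rw [hQ]
    refine Finset.sum_le_sum fun y _ => ?_
    rw [htc]
    exact ENNReal.mul_div_le
  have hQl : ∑ X, Q (Fin.last k) X ≤
      N * ∏ m : Fin (k + 1), ∏ j with j ≠ m.castSucc ∧ j ≠ m.succ, ∑ q, a j q := by
    rw [hQ, htl]
    simp only [mul_one, Fin.succ_last]
    rw [Finset.sum_transfer_eq_sum_path (k + 1) M D hD]
    simp only [hD0, one_mul]
    exact Finset.sum_path_le_card_mul_prod k R a N hN M fun _ _ _ => rfl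
  have hpt (X : Fin (k + 2) → A) (hX : X ∈ R) : ∏ j, a j (X j) ^ k ≤ ∏ m, Q m X := by
    by_cases hpos : ∀ j, a j (X j) ≠ 0
    · have hDpos (i : Fin (k + 2)) : D i (X i) ≠ 0 := by
        induction i using Fin.induction with
        | zero => simp [hD0]
        | succ m ih =>
          rw [hD', Ne, Finset.sum_eq_zero_iff]
          push Not
          exact ⟨X, by simp [hX], mul_ne_zero ih (Finset.prod_ne_zero_iff.2 fun j _ => hpos j)⟩
      simp only [Q, if_pos hX]
      rw [Finset.prod_mul_distrib, Finset.prod_mul_distrib, Fin.prod_univ_succ (n := k),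
        Fin.prod_univ_castSucc (f := fun m => t m (X m.succ))]
      simp only [htl, htc, hD0, Fin.castSucc_zero, mul_one, one_mul]
      rw [← Fin.prod_prod_ne_castSucc_succ k fun j => a j (X j), mul_right_comm,
        ← Finset.prod_mul_distrib, mul_comm]
      simp only [w]
      gcongr with i
      rw [← Fin.succ_castSucc, ENNReal.mul_div_cancel (hDpos _) (hDtop _ _)]
    · push Not at hpos
      obtain ⟨j, hj⟩ := hpos
      rcases k.eq_zero_or_pos with rfl | hk
      · have : Q 0 X = 1 := by
          have h0 : (Finset.univ.filter fun j : Fin 2 =>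
            j ≠ (0 : Fin 1).castSucc ∧ j ≠ (0 : Fin 1).succ) = ∅ := by decide
          have ht0 : t 0 = fun _ => 1 := htl
          simp only [Q, if_pos hX, w, h0, ht0]
          simp [hD0]
        simp [this]
      · rw [Finset.prod_eq_zero (Finset.mem_univ j) (by simp [hj, hk.ne'])]
        exact zero_le
  have hk1 : (0 : ℝ) < k + 1 := by positivity
  let _ : MeasurableSpace (Fin (k + 2) → A) := ⊤
  calc ∑ X with X ∈ R, ∏ j, a j (X j) ^ ((k : ℝ) / (k + 1))
      ≤ ∑ X with X ∈ R, ∏ m, Q m X ^ (1 / ((k : ℝ) + 1)) := by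
        refine Finset.sum_le_sum fun X hX => ?_
        rw [ENNReal.prod_rpow_of_nonneg (r := 1 / ((k : ℝ) + 1)) (by positivity)]
        refine le_trans (le_of_eq ?_)
          (ENNReal.rpow_le_rpow (hpt X (Finset.mem_filter.1 hX).2) (by positivity))
        rw [← ENNReal.prod_rpow_of_nonneg (by positivity)]
        refine Finset.prod_congr rfl fun j _ => ?_
        rw [← ENNReal.rpow_natCast, ← ENNReal.rpow_mul, mul_one_div]
    _ ≤ ∑ X, ∏ m, Q m X ^ (1 / ((k : ℝ) + 1)) :=
        Finset.sum_le_sum_of_subset (Finset.filter_subset _ _)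
    _ = ∫⁻ X, ∏ m, Q m X ^ (1 / ((k : ℝ) + 1)) ∂Measure.count := by
        rw [lintegral_fintype]; simp
    _ ≤ ∏ m, (∫⁻ X, Q m X ∂Measure.count) ^ (1 / ((k : ℝ) + 1)) := by
        refine ENNReal.lintegral_prod_norm_pow_le _ (fun _ _ => measurable_from_top.aemeasurable)
          ?_ fun _ _ => by positivity
        simp [hk1.ne']
    _ = (∏ m, ∑ X, Q m X) ^ (1 / ((k : ℝ) + 1)) := by
        rw [ENNReal.prod_rpow_of_nonneg (by positivity)]
        congr! 2
        rw [lintegral_fintype]; simp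
    _ ≤ ((∏ i : Fin k, ∑ q, a i.castSucc.succ q) * (N * ∏ m : Fin (k + 1),
          ∏ j with j ≠ m.castSucc ∧ j ≠ m.succ, ∑ q, a j q)) ^ (1 / ((k : ℝ) + 1)) := by
        refine ENNReal.rpow_le_rpow ?_ (by positivity)
        rw [Fin.prod_univ_castSucc]
        gcongr with i
        exact hQc i
    _ = _ := by
        rw [mul_left_comm, mul_comm (∏ i : Fin k, _), Fin.prod_prod_ne_castSucc_succ,
          ENNReal.mul_rpow_of_nonneg _ _ (by positivity),
          ← ENNReal.prod_rpow_of_nonneg (by positivity)]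
        congr 1
        refine Finset.prod_congr rfl fun j _ => ?_
        rw [← ENNReal.rpow_natCast, ← ENNReal.rpow_mul, mul_one_div]

theorem IsCompact.exists_pos_forall_mul_norm_le_of_injective {X E F : Type*} [TopologicalSpace X]
    [NormedAddCommGroup E] [NormedSpace ℝ E] [FiniteDimensional ℝ E]
    [NormedAddCommGroup F] [NormedSpace ℝ F] {K : Set X} (hK : IsCompact K) {f : X → E →L[ℝ] F}
    (hf : Continuous f) (hinj : ∀ x ∈ K, Function.Injective (f x)) :
    ∃ c > 0, ∀ x ∈ K, ∀ u, c * ‖u‖ ≤ ‖f x u‖ := by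
  have hcomp : IsCompact (K ×ˢ sphere (0 : E) 1) := hK.prod (isCompact_sphere 0 1)
  have hcont : Continuous fun p : X × E => ‖f p.1 p.2‖ := by fun_prop
  obtain ⟨c, hc, h⟩ : ∃ c > 0, ∀ p ∈ K ×ˢ sphere (0 : E) 1, c ≤ ‖f p.1 p.2‖ := by
    rcases (K ×ˢ sphere (0 : E) 1).eq_empty_or_nonempty with h | h
    · exact ⟨1, one_pos, by simp [h]⟩
    · obtain ⟨p, hp, hmin⟩ := hcomp.exists_isMinOn h hcont.continuousOn
      refine ⟨_, norm_pos_iff.2 fun h0 => ?_, fun q hq => hmin hq⟩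
      have hp2 : p.2 = 0 := hinj p.1 hp.1 (by rw [h0, map_zero])
      have := hp.2
      simp [hp2] at this
  refine ⟨c, hc, fun x hx u => ?_⟩
  rcases eq_or_ne u 0 with rfl | hu
  · simp
  have := h (x, ‖u‖⁻¹ • u) ⟨hx, by simp [norm_smul, hu]⟩
  simp only [map_smul, norm_smul, norm_inv, norm_norm] at this
  have hu' := norm_pos_iff.2 hu
  calc c * ‖u‖ ≤ ‖u‖⁻¹ * ‖f x u‖ * ‖u‖ := by gcongr
    _ = ‖f x u‖ := by field_simp

theorem IsCompact.exists_forall_norm_sub_sub_fderiv_le {E F : Type*}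
    [NormedAddCommGroup E] [NormedSpace ℝ E] [NormedAddCommGroup F] [NormedSpace ℝ F]
    {K : Set E} (hK : IsCompact K) {S : E → F} (hS : ContDiff ℝ 1 S) {ε : ℝ} (hε : 0 < ε) :
    ∃ r > 0, ∀ x ∈ K, ∀ y, dist x y < r →
      ‖S y - S x - fderiv ℝ S x (y - x)‖ ≤ ε * ‖y - x‖ := by
  have hcont : Continuous (fderiv ℝ S) := hS.continuous_fderiv one_ne_zero
  have := hK.uniformContinuousAt_of_continuousAt (fderiv ℝ S) (fun a _ => hcont.continuousAt)
    (dist_mem_uniformity hε)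
  obtain ⟨r, hr, h⟩ := Metric.mem_uniformity_dist.1 this
  refine ⟨r, hr, fun x hx y hxy => ?_⟩
  refine Convex.norm_image_sub_le_of_norm_hasFDerivWithin_le' (𝕜 := ℝ) (s := ball x r)
    (fun z _ => ((hS.differentiable one_ne_zero) z).hasFDerivAt.hasFDerivWithinAt) (fun z hz => ?_)
    (convex_ball x r) (mem_ball_self hr) (by rwa [mem_ball, dist_comm])
  have := h (a := x) (b := z) (by rw [dist_comm]; exact hz) hx
  rw [← dist_eq_norm, dist_comm]
  exact this.le

theorem norm_le_of_forall_abs_inner_le {n : ℕ} {ν₀ : ℝ} (hν₀ : 0 < ν₀)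
    (ν : Fin n → EuclideanSpace ℝ (Fin n)) (hν : ∀ j, ‖ν j‖ = 1)
    (hdet : ν₀ ≤ |Matrix.det (Matrix.of fun i j => ν j i)|)
    (v : EuclideanSpace ℝ (Fin n)) {s : ℝ} (hs : ∀ j, |⟪ν j, v⟫_ℝ| ≤ s) :
    ‖v‖ ≤ n * (n * n.factorial / ν₀) * s := by
  let A : Matrix (Fin n) (Fin n) ℝ := Matrix.of fun j i => ν j i
  have hA : Matrix.det A = Matrix.det (Matrix.of fun i j => ν j i) :=
    (Matrix.det_transpose A).symm
  have hcoord (j i : Fin n) : |A j i| ≤ 1 := by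
    rw [← hν j]
    exact PiLp.norm_apply_le (ν j) i
  have hadj (i j : Fin n) : |A.adjugate i j| ≤ n.factorial := by
    rw [Matrix.adjugate_apply]
    have := Matrix.det_le (A := A.updateRow j (Pi.single i 1)) (abv := AbsoluteValue.abs) (x := 1)
      (fun a b => by
        rw [Matrix.updateRow_apply]
        split_ifs
        · rw [Pi.single_apply]
          split_ifs <;> simp
        · exact hcoord a b)
    simpa using this
  have hmul (j : Fin n) : (A.mulVec v) j = ⟪ν j, v⟫_ℝ := by
    simp [Matrix.mulVec, dotProduct, A, PiLp.inner_apply, mul_comm]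
  have hvi (i : Fin n) : |v i| ≤ n * n.factorial / ν₀ * s := by
    have h1 : A.det * v i = ∑ j, A.adjugate i j * ⟪ν j, v⟫_ℝ := by
      have : (A.adjugate * A).mulVec v i = A.det * v i := by
        rw [Matrix.adjugate_mul, Matrix.smul_mulVec, Matrix.one_mulVec]; rfl
      rw [← this, ← Matrix.mulVec_mulVec]
      simp only [Matrix.mulVec, dotProduct] at hmul ⊢
      simp_rw [hmul]
    have h2 : ν₀ * |v i| ≤ n * (n.factorial * s) := by
      calc ν₀ * |v i| ≤ |A.det| * |v i| := by gcongr; rw [hA]; exact hdet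
        _ = |∑ j, A.adjugate i j * ⟪ν j, v⟫_ℝ| := by rw [← abs_mul, h1]
        _ ≤ ∑ j, |A.adjugate i j * ⟪ν j, v⟫_ℝ| := Finset.abs_sum_le_sum_abs _ _
        _ ≤ ∑ _j : Fin n, (n.factorial : ℝ) * s := by
          refine Finset.sum_le_sum fun j _ => ?_
          rw [abs_mul]
          exact mul_le_mul (hadj i j) (hs j) (abs_nonneg _) (by positivity)
        _ = n * (n.factorial * s) := by simp
    rw [div_mul_eq_mul_div, le_div_iff₀ hν₀]
    linarith
  calc ‖v‖ = ‖∑ i, v i • EuclideanSpace.basisFun (Fin n) ℝ i‖ := by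
        conv_lhs => rw [← (EuclideanSpace.basisFun (Fin n) ℝ).sum_repr v]
        rfl
    _ ≤ ∑ i, ‖v i • EuclideanSpace.basisFun (Fin n) ℝ i‖ := norm_sum_le _ _
    _ = ∑ i, |v i| := by simp [norm_smul]
    _ ≤ ∑ _i : Fin n, (n * n.factorial / ν₀ * s) := Finset.sum_le_sum fun i _ => hvi i
    _ = _ := by simp; ring

theorem norm_sub_neg_one_pow_smul_le {F : Type*} [NormedAddCommGroup F] [NormedSpace ℝ F] {n : ℕ}
    (v : Fin (n + 1) → F) {t : ℝ} (hv : ∀ m : Fin n, ‖v m.castSucc + v m.succ‖ ≤ t)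
    (j : Fin (n + 1)) : ‖v 0 - (-1 : ℝ) ^ (j : ℕ) • v j‖ ≤ j * t := by
  induction j using Fin.induction with
  | zero => simp
  | succ m ih =>
    have : v 0 - (-1 : ℝ) ^ (m.succ : ℕ) • v m.succ =
        (v 0 - (-1 : ℝ) ^ (m.castSucc : ℕ) • v m.castSucc) +
          (-1 : ℝ) ^ (m : ℕ) • (v m.castSucc + v m.succ) := by
      simp only [Fin.val_succ, Fin.val_castSucc, pow_succ]
      module
    rw [this]
    refine (norm_add_le _ _).trans ?_
    rw [norm_smul, norm_pow, norm_neg, norm_one, one_pow, one_mul]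
    have := hv m
    simp only [Fin.val_castSucc] at ih ⊢
    rw [Fin.val_succ]
    push_cast
    linarith

theorem norm_le_of_norm_castSucc_add_succ_le {n : ℕ} {ν₀ : ℝ} (hν₀ : 0 < ν₀)
    (ν : Fin (n + 1) → EuclideanSpace ℝ (Fin (n + 1))) (hν : ∀ j, ‖ν j‖ = 1)
    (hdet : ν₀ ≤ |Matrix.det (Matrix.of fun i j => ν j i)|)
    (v : Fin (n + 1) → EuclideanSpace ℝ (Fin (n + 1))) (hperp : ∀ j, ⟪ν j, v j⟫_ℝ = 0)
    {t : ℝ} (ht : 0 ≤ t) (hv : ∀ m : Fin n, ‖v m.castSucc + v m.succ‖ ≤ t) (j : Fin (n + 1)) :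
    ‖v j‖ ≤ (((n + 1 : ℕ) * ((n + 1 : ℕ) * (n + 1).factorial / ν₀) + 1) * n) * t := by
  have hdiff (j : Fin (n + 1)) : ‖v 0 - (-1 : ℝ) ^ (j : ℕ) • v j‖ ≤ n * t := by
    refine (norm_sub_neg_one_pow_smul_le v hv j).trans ?_
    have : ((j : ℕ) : ℝ) ≤ n := by exact_mod_cast Nat.lt_succ_iff.1 j.2
    gcongr
  have h0 : ‖v 0‖ ≤ ((n + 1 : ℕ) * ((n + 1 : ℕ) * (n + 1).factorial / ν₀)) * (n * t) := by
    refine norm_le_of_forall_abs_inner_le hν₀ ν hν hdet _ fun j => ?_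
    have : ⟪ν j, v 0⟫_ℝ = ⟪ν j, v 0 - (-1 : ℝ) ^ (j : ℕ) • v j⟫_ℝ := by
      rw [inner_sub_right, inner_smul_right, hperp, mul_zero, sub_zero]
    rw [this]
    refine (abs_real_inner_le_norm _ _).trans ?_
    rw [hν, one_mul]
    exact hdiff j
  have hj : ‖v j‖ ≤ ‖v 0‖ + n * t := by
    have h1 : ‖v j‖ = ‖(-1 : ℝ) ^ (j : ℕ) • v j‖ := by simp [norm_smul]
    rw [h1]
    have := norm_sub_le (v 0) (v 0 - (-1 : ℝ) ^ (j : ℕ) • v j)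
    rw [sub_sub_cancel] at this
    exact this.trans (by gcongr; exact hdiff j)
  linarith

/-- The hypersurface data enters the restriction estimate only through the existence of the
constants `r`, `C`, `L` below. -/
theorem exists_norm_sub_le_of_transversal (n : ℕ) {ν₀ : ℝ} (hν₀ : 0 < ν₀)
    (K : Fin (n + 1) → Set (EuclideanSpace ℝ (Fin n))) (hK : ∀ j, IsCompact (K j))
    (S : Fin (n + 1) → EuclideanSpace ℝ (Fin n) → EuclideanSpace ℝ (Fin (n + 1)))
    (hS : ∀ j, ContDiff ℝ 1 (S j))
    (hSimm : ∀ j, ∀ x ∈ K j, Function.Injective (fderiv ℝ (S j) x))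
    (ν : Fin (n + 1) → EuclideanSpace ℝ (Fin n) → EuclideanSpace ℝ (Fin (n + 1)))
    (hνunit : ∀ j, ∀ x ∈ K j, ‖ν j x‖ = 1)
    (hνperp : ∀ j, ∀ x ∈ K j, ∀ v, ⟪ν j x, fderiv ℝ (S j) x v⟫_ℝ = 0)
    (htrans : ∀ x : (j : Fin (n + 1)) → EuclideanSpace ℝ (Fin n),
      (∀ j, x j ∈ K j) → ν₀ ≤ |Matrix.det (Matrix.of fun i j => ν j (x j) i)|) :
    ∃ r > 0, ∃ C > 0, ∃ L > 0,
      (∀ j, ∀ x ∈ K j, ∀ y, dist x y ≤ r → ‖S j y - S j x‖ ≤ L * ‖y - x‖) ∧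
      ∀ y y' : Fin (n + 1) → EuclideanSpace ℝ (Fin n), (∀ j, y j ∈ K j) →
        (∀ j, dist (y j) (y' j) ≤ r) → ∀ t, 0 ≤ t →
        (∀ m : Fin n, ‖(S m.castSucc (y' m.castSucc) - S m.castSucc (y m.castSucc)) +
          (S m.succ (y' m.succ) - S m.succ (y m.succ))‖ ≤ t) →
        ‖y' - y‖ ≤ C * t := by
  choose c hc hlow using fun j => (hK j).exists_pos_forall_mul_norm_le_of_injective
    ((hS j).continuous_fderiv one_ne_zero) (hSimm j)
  obtain ⟨c₀, hc₀, hc₀le⟩ : ∃ c₀ > 0, ∀ j, c₀ ≤ c j :=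
    ⟨Finset.univ.inf' Finset.univ_nonempty c, by simpa using hc, fun j => Finset.inf'_le _ (by simp)⟩
  choose B hB using fun j => (hK j).exists_bound_of_continuousOn (f := fderiv ℝ (S j))
    ((hS j).continuous_fderiv one_ne_zero).continuousOn
  set C₁ : ℝ := (((n + 1 : ℕ) * ((n + 1 : ℕ) * (n + 1).factorial / ν₀) + 1) * n) with hC₁
  have hC₁0 : 0 ≤ C₁ := by positivity
  set ε : ℝ := c₀ / (4 * (C₁ + 1)) with hε
  have hε0 : 0 < ε := by positivity
  choose r hr hlin using fun j => (hK j).exists_forall_norm_sub_sub_fderiv_le (hS j) hε0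
  obtain ⟨r₀, hr₀, hr₀lt⟩ : ∃ r₀ > 0, ∀ j, r₀ < r j := by
    refine ⟨Finset.univ.inf' Finset.univ_nonempty r / 2, by simpa using hr, fun j => ?_⟩
    have h1 : Finset.univ.inf' Finset.univ_nonempty r ≤ r j := Finset.inf'_le _ (by simp)
    have := hr j
    linarith
  refine ⟨r₀, hr₀, 2 / c₀ * (C₁ + 1), by positivity,
    Finset.univ.sup' Finset.univ_nonempty (fun j => |B j|) + ε, ?_, ?_, ?_⟩
  · have : (0 : ℝ) ≤ Finset.univ.sup' Finset.univ_nonempty (fun j => |B j|) :=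
      (abs_nonneg (B 0)).trans (Finset.le_sup' (fun j => |B j|) (Finset.mem_univ 0))
    positivity
  · intro j x hx y hxy
    have h1 := hlin j x hx y (hxy.trans_lt (hr₀lt j))
    have h2 := (fderiv ℝ (S j) x).le_of_opNorm_le (hB j x hx) (y - x)
    have h3 : B j ≤ Finset.univ.sup' Finset.univ_nonempty (fun j => |B j|) :=
      (le_abs_self _).trans (Finset.le_sup' (fun j => |B j|) (Finset.mem_univ j))
    have h4 := norm_le_norm_sub_add (S j y - S j x) (fderiv ℝ (S j) x (y - x))
    have h5 := mul_le_mul_of_nonneg_right h3 (norm_nonneg (y - x))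
    linarith
  · intro y y' hy hyy t ht hm
    set T := ‖y' - y‖ with hT
    have hTj (j) : ‖y' j - y j‖ ≤ T := norm_le_pi_norm (y' - y) j
    let v (j : Fin (n + 1)) := fderiv ℝ (S j) (y j) (y' j - y j)
    have herr (j) : ‖S j (y' j) - S j (y j) - v j‖ ≤ ε * T :=
      (hlin j _ (hy j) _ ((hyy j).trans_lt (hr₀lt j))).trans (by gcongr; exact hTj j)
    have hT0 : 0 ≤ T := norm_nonneg _
    have hv (m : Fin n) : ‖v m.castSucc + v m.succ‖ ≤ t + 2 * ε * T := by
      have h1 := herr m.castSucc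
      have h2 := herr m.succ
      have h3 : v m.castSucc + v m.succ =
        ((S m.castSucc (y' m.castSucc) - S m.castSucc (y m.castSucc)) +
          (S m.succ (y' m.succ) - S m.succ (y m.succ))) -
        ((S m.castSucc (y' m.castSucc) - S m.castSucc (y m.castSucc) - v m.castSucc) +
          (S m.succ (y' m.succ) - S m.succ (y m.succ) - v m.succ)) := by abel
      rw [h3]
      refine (norm_sub_le _ _).trans ?_
      have h4 := norm_add_le (S m.castSucc (y' m.castSucc) - S m.castSucc (y m.castSucc) -
        v m.castSucc) (S m.succ (y' m.succ) - S m.succ (y m.succ) - v m.succ)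
      have := hm m
      linarith
    have hvj (j) : c₀ * ‖y' j - y j‖ ≤ C₁ * (t + 2 * ε * T) := by
      refine le_trans ?_ (norm_le_of_norm_castSucc_add_succ_le hν₀ (fun j => ν j (y j))
        (fun j => hνunit j _ (hy j)) (htrans y hy) v (fun j => hνperp j _ (hy j) _)
        (by positivity) hv j)
      exact le_trans (by gcongr; exact hc₀le j) (hlow j _ (hy j) _)
    have hTle : T ≤ C₁ * (t + 2 * ε * T) / c₀ := by
      refine (pi_norm_le_iff_of_nonneg (by positivity)).2 fun j => ?_
      rw [le_div_iff₀ hc₀, mul_comm]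
      exact hvj j
    rw [le_div_iff₀ hc₀] at hTle
    have hεC : 2 * ε * C₁ ≤ c₀ / 2 := by
      rw [hε, div_eq_mul_inv c₀ (4 * (C₁ + 1))]
      field_simp
      linarith
    have h6 : c₀ / 2 * T ≤ C₁ * t := by
      have := mul_le_mul_of_nonneg_right hεC hT0
      nlinarith
    have h7 : T ≤ 2 / c₀ * (C₁ * t) := by
      rw [div_mul_eq_mul_div, le_div_iff₀ hc₀]
      linarith
    rw [mul_assoc]
    exact h7.trans (by gcongr; linarith)

/-- The index of the half-open cube of side length `δ` containing `x`. -/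
noncomputable def cubeIndex {n : ℕ} (δ : ℝ) (x : EuclideanSpace ℝ (Fin n)) : Fin n → ℤ :=
  fun i => ⌊x i / δ⌋

theorem measurable_cubeIndex {n : ℕ} (δ : ℝ) :
    Measurable (cubeIndex δ : EuclideanSpace ℝ (Fin n) → Fin n → ℤ) :=
  measurable_pi_lambda _ fun i => Int.measurable_floor.comp (by fun_prop)

theorem norm_sub_le_of_cubeIndex_eq {n : ℕ} {δ : ℝ} (hδ : 0 < δ)
    {x y : EuclideanSpace ℝ (Fin n)} (h : cubeIndex δ x = cubeIndex δ y) :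
    ‖x - y‖ ≤ n * δ := by
  have hi (i : Fin n) : |(x - y) i| ≤ δ := by
    have := Int.abs_sub_lt_one_of_floor_eq_floor (congrFun h i)
    rw [← sub_div, abs_div, abs_of_pos hδ, div_lt_one hδ] at this
    exact this.le
  calc ‖x - y‖ = ‖∑ i, (x - y) i • EuclideanSpace.basisFun (Fin n) ℝ i‖ := by
        conv_lhs => rw [← (EuclideanSpace.basisFun (Fin n) ℝ).sum_repr (x - y)]
        rfl
    _ ≤ ∑ i, ‖(x - y) i • EuclideanSpace.basisFun (Fin n) ℝ i‖ := norm_sum_le _ _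
    _ = ∑ i, |(x - y) i| := by simp [norm_smul]
    _ ≤ ∑ _i : Fin n, δ := Finset.sum_le_sum fun i _ => hi i
    _ = _ := by simp

theorem abs_cubeIndex_sub_le {n : ℕ} {δ ρ : ℝ} (hδ : 0 < δ) {x y : EuclideanSpace ℝ (Fin n)}
    (h : ‖x - y‖ ≤ ρ * δ) (i : Fin n) : |cubeIndex δ x i - cubeIndex δ y i| ≤ ⌈ρ⌉₊ + 1 := by
  have h1 : |x i / δ - y i / δ| ≤ ρ := by
    rw [← sub_div, abs_div, abs_of_pos hδ, div_le_iff₀ hδ]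
    exact (PiLp.norm_apply_le (x - y) i).trans h
  have h2 : |((cubeIndex δ x i - cubeIndex δ y i : ℤ) : ℝ)| < ((⌈ρ⌉₊ + 2 : ℤ) : ℝ) := by
    have hρ := Nat.le_ceil ρ
    have a1 := Int.floor_le (x i / δ)
    have a2 := Int.lt_floor_add_one (x i / δ)
    have b1 := Int.floor_le (y i / δ)
    have b2 := Int.lt_floor_add_one (y i / δ)
    simp only [cubeIndex]
    push_cast
    rw [abs_le] at h1
    rw [abs_lt]
    constructor <;> linarith
  rw [← Int.cast_abs, Int.cast_lt] at h2
  omega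

theorem volume_cubeIndex_eq_le {n : ℕ} {δ : ℝ} (hδ : 0 < δ) (q : Fin n → ℤ) :
    volume {x : EuclideanSpace ℝ (Fin n) | cubeIndex δ x = q} ≤ ENNReal.ofReal δ ^ n := by
  have hsub : {x : EuclideanSpace ℝ (Fin n) | cubeIndex δ x = q} ⊆ (WithLp.ofLp) ⁻¹'
      (Set.univ.pi fun i => Set.Ico (q i * δ) ((q i + 1) * δ)) := by
    intro x hx i _
    have := congrFun hx i
    simp only [cubeIndex] at this
    rw [Int.floor_eq_iff, le_div_iff₀ hδ, div_lt_iff₀ hδ] at this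
    exact this
  refine (measure_mono hsub).trans ?_
  rw [(PiLp.volume_preserving_ofLp (Fin n)).measure_preimage
    (MeasurableSet.univ_pi fun i => measurableSet_Ico).nullMeasurableSet, volume_pi_pi]
  simp [add_mul]

theorem Bornology.IsBounded.finite_image_cubeIndex {n : ℕ} {U : Set (EuclideanSpace ℝ (Fin n))}
    (hU : Bornology.IsBounded U) (δ : ℝ) : (cubeIndex δ '' U).Finite := by
  obtain ⟨B, hB⟩ := hU.exists_norm_le
  refine (Set.finite_Icc (fun _ : Fin n => ⌊-|B / δ|⌋) (fun _ => ⌊|B / δ|⌋)).subset ?_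
  rintro _ ⟨x, hx, rfl⟩
  have hi (i : Fin n) : |x i / δ| ≤ |B / δ| := by
    rw [abs_div, abs_div]
    exact div_le_div_of_nonneg_right
      (((PiLp.norm_apply_le x i).trans (hB x hx)).trans (le_abs_self _)) (abs_nonneg _)
  exact ⟨fun i => Int.floor_le_floor (abs_le.1 (hi i)).1,
    fun i => Int.floor_le_floor (abs_le.1 (hi i)).2⟩

theorem Set.ncard_le_of_forall_abs_sub_le {ι κ : Type*} [Fintype ι] [Fintype κ]
    {A : Finset (κ → ℤ)} (s : Set (ι → A)) (B : ℕ)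
    (h : ∀ Y ∈ s, ∀ Y' ∈ s, ∀ j i, |(Y j : κ → ℤ) i - (Y' j : κ → ℤ) i| ≤ B) :
    s.ncard ≤ (2 * B + 1) ^ (Fintype.card κ * Fintype.card ι) := by
  classical
  rcases s.eq_empty_or_nonempty with rfl | ⟨Y₀, hY₀⟩
  · simp
  let lo : ι → κ → ℤ := fun j i => (Y₀ j : κ → ℤ) i - B
  let hi : ι → κ → ℤ := fun j i => (Y₀ j : κ → ℤ) i + B
  have hcard : (Finset.Icc lo hi).card = (2 * B + 1) ^ (Fintype.card κ * Fintype.card ι) := by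
    rw [Pi.card_Icc]
    simp_rw [Pi.card_Icc, Int.card_Icc, lo, hi]
    have : ∀ a : ℤ, (a + B + 1 - (a - B)).toNat = 2 * B + 1 := fun a => by omega
    simp [this, pow_mul]
  rw [← hcard, ← Set.ncard_coe_finset]
  refine Set.ncard_le_ncard_of_injOn (fun Y j => (Y j : κ → ℤ)) (fun Y hY => ?_) ?_
    (Finset.finite_toSet _)
  · rw [Finset.coe_Icc]
    refine ⟨fun j i => ?_, fun j i => ?_⟩ <;>
    · have := abs_le.1 (h Y hY Y₀ hY₀ j i)
      simp only [lo, hi]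
      omega
  · intro Y _ Y' _ hYY
    exact funext fun j => Subtype.ext (congrFun hYY j)

theorem abs_cubeIndex_sub_le_of_path {n : ℕ} {U : Fin (n + 1) → Set (EuclideanSpace ℝ (Fin n))}
    {S : Fin (n + 1) → EuclideanSpace ℝ (Fin n) → EuclideanSpace ℝ (Fin (n + 1))} {L C δ : ℝ}
    (hn : 1 ≤ n) (hL₀ : 0 ≤ L)
    (hL : ∀ j, ∀ x ∈ U j, ∀ y ∈ U j, ‖S j y - S j x‖ ≤ L * ‖y - x‖)
    (hC : ∀ y y' : Fin (n + 1) → EuclideanSpace ℝ (Fin n),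
      (∀ j, y j ∈ U j) → (∀ j, y' j ∈ U j) → ∀ t, 0 ≤ t →
      (∀ m : Fin n, ‖(S m.castSucc (y' m.castSucc) - S m.castSucc (y m.castSucc)) +
        (S m.succ (y' m.succ) - S m.succ (y m.succ))‖ ≤ t) → ‖y' - y‖ ≤ C * t)
    (hδ : 0 < δ) (ξ : EuclideanSpace ℝ (Fin (n + 1)))
    (P : Fin n → Fin (n + 1) → Fin n → ℤ) {Y Y' : Fin (n + 1) → Fin n → ℤ}
    (hY : ∀ m : Fin n, ∃ x : Fin (n + 1) → EuclideanSpace ℝ (Fin n), (∀ j, x j ∈ U j) ∧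
      ‖∑ j, S j (x j) - ξ‖ ≤ δ ∧ cubeIndex δ (x m.castSucc) = Y m.castSucc ∧
      cubeIndex δ (x m.succ) = Y m.succ ∧
      ∀ j, j ≠ m.castSucc → j ≠ m.succ → cubeIndex δ (x j) = P m j)
    (hY' : ∀ m : Fin n, ∃ x : Fin (n + 1) → EuclideanSpace ℝ (Fin n), (∀ j, x j ∈ U j) ∧
      ‖∑ j, S j (x j) - ξ‖ ≤ δ ∧ cubeIndex δ (x m.castSucc) = Y' m.castSucc ∧
      cubeIndex δ (x m.succ) = Y' m.succ ∧
      ∀ j, j ≠ m.castSucc → j ≠ m.succ → cubeIndex δ (x j) = P m j)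
    (j : Fin (n + 1)) (i : Fin n) :
    |Y j i - Y' j i| ≤ ⌈C * (2 + (n + 1) * (2 * (L * n)))⌉₊ + 1 := by
  have rep {Z : Fin (n + 1) → Fin n → ℤ}
      (hZ : ∀ m : Fin n, ∃ x : Fin (n + 1) → EuclideanSpace ℝ (Fin n), (∀ j, x j ∈ U j) ∧
        ‖∑ j, S j (x j) - ξ‖ ≤ δ ∧ cubeIndex δ (x m.castSucc) = Z m.castSucc ∧
        cubeIndex δ (x m.succ) = Z m.succ ∧
        ∀ j, j ≠ m.castSucc → j ≠ m.succ → cubeIndex δ (x j) = P m j) (j : Fin (n + 1)) :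
      ∃ y ∈ U j, cubeIndex δ y = Z j := by
    cases j using Fin.cases with
    | zero =>
      obtain ⟨x, hx, -, h, -⟩ := hZ ⟨0, hn⟩
      exact ⟨_, hx _, h⟩
    | succ m =>
      obtain ⟨x, hx, -, -, h, -⟩ := hZ m
      exact ⟨_, hx _, h⟩
  choose y hyU hy using rep hY
  choose y' hyU' hy' using rep hY'
  have hLip {j : Fin (n + 1)} {a b : EuclideanSpace ℝ (Fin n)} (ha : a ∈ U j) (hb : b ∈ U j)
      (h : cubeIndex δ a = cubeIndex δ b) : ‖S j a - S j b‖ ≤ L * n * δ := by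
    refine (hL j b hb a ha).trans ?_
    rw [mul_assoc]
    gcongr
    exact norm_sub_le_of_cubeIndex_eq hδ h
  have key := hC y y' hyU hyU' ((2 + (n + 1) * (2 * (L * n))) * δ) (by positivity) fun m => by
    obtain ⟨x, hxU, hxξ, hx1, hx2, hx3⟩ := hY m
    obtain ⟨x', hxU', hxξ', hx1', hx2', hx3'⟩ := hY' m
    have hne : m.castSucc ≠ m.succ := (Fin.castSucc_lt_succ).ne
    let w : Fin (n + 1) → EuclideanSpace ℝ (Fin (n + 1)) := fun j =>
      (if j = m.castSucc then S j (y' j) - S j (y j) else 0) +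
        (if j = m.succ then S j (y' j) - S j (y j) else 0)
    have hw : ∑ j, w j = (S m.castSucc (y' m.castSucc) - S m.castSucc (y m.castSucc)) +
        (S m.succ (y' m.succ) - S m.succ (y m.succ)) := by
      simp [w, Finset.sum_add_distrib]
    have hbound (j : Fin (n + 1)) :
        ‖w j - (S j (x' j) - S j (x j))‖ ≤ 2 * (L * n * δ) := by
      by_cases h1 : j = m.castSucc
      · subst h1
        have a1 := hLip (hyU m.castSucc) (hxU _) ((hy _).trans hx1.symm)
        have a2 := hLip (hyU' m.castSucc) (hxU' _) ((hy' _).trans hx1'.symm)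
        have : w m.castSucc - (S m.castSucc (x' m.castSucc) - S m.castSucc (x m.castSucc)) =
            (S m.castSucc (y' m.castSucc) - S m.castSucc (x' m.castSucc)) -
            (S m.castSucc (y m.castSucc) - S m.castSucc (x m.castSucc)) := by
          simp only [w, if_true, if_neg hne, add_zero]; abel
        rw [this]
        exact (norm_sub_le _ _).trans (by linarith)
      by_cases h2 : j = m.succ
      · subst h2
        have a1 := hLip (hyU m.succ) (hxU _) ((hy _).trans hx2.symm)
        have a2 := hLip (hyU' m.succ) (hxU' _) ((hy' _).trans hx2'.symm)
        have : w m.succ - (S m.succ (x' m.succ) - S m.succ (x m.succ)) =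
            (S m.succ (y' m.succ) - S m.succ (x' m.succ)) -
            (S m.succ (y m.succ) - S m.succ (x m.succ)) := by
          simp only [w, if_true, if_neg hne.symm, zero_add]; abel
        rw [this]
        exact (norm_sub_le _ _).trans (by linarith)
      · have a1 := hLip (hxU' j) (hxU j) ((hx3' j h1 h2).trans (hx3 j h1 h2).symm)
        have : 0 ≤ L * n * δ := by positivity
        simp only [w, if_neg h1, if_neg h2, add_zero, zero_sub, norm_neg]
        linarith
    have : ∑ j, w j = (∑ j, S j (x' j) - ξ) - (∑ j, S j (x j) - ξ) +
        ∑ j, (w j - (S j (x' j) - S j (x j))) := by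
      simp only [Finset.sum_sub_distrib]; abel
    rw [← hw, this]
    calc _ ≤ ‖(∑ j, S j (x' j) - ξ) - (∑ j, S j (x j) - ξ)‖ +
          ‖∑ j, (w j - (S j (x' j) - S j (x j)))‖ := norm_add_le _ _
      _ ≤ (δ + δ) + ∑ _j : Fin (n + 1), 2 * (L * n * δ) := by
        gcongr
        · exact (norm_sub_le _ _).trans (add_le_add hxξ' hxξ)
        · exact (norm_sum_le _ _).trans (Finset.sum_le_sum fun j _ => hbound j)
      _ = _ := by simp; ring
  rw [← mul_assoc] at key
  rw [← hy, ← hy', abs_sub_comm]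
  exact abs_cubeIndex_sub_le hδ ((norm_le_pi_norm (y' - y) j).trans key) i

theorem lintegral_fin_prod_eq_prod {n : ℕ} {E : Type*} [MeasurableSpace E]
    (μ : Fin n → Measure E) [∀ i, SigmaFinite (μ i)] (f : Fin n → E → ℝ≥0∞)
    (hf : ∀ i, Measurable (f i)) :
    ∫⁻ x, ∏ i, f i (x i) ∂(Measure.pi μ) = ∏ i, ∫⁻ x, f i x ∂(μ i) := by
  induction n with
  | zero => simp
  | succ n ih =>
    have hm := (measurePreserving_piFinSuccAbove μ 0).symm
    rw [← hm.lintegral_comp_emb (MeasurableEquiv.measurableEmbedding _)]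
    simp_rw [Fin.prod_univ_succ, MeasurableEquiv.piFinSuccAbove_symm_apply, Fin.insertNthEquiv,
      Fin.zero_succAbove, Equiv.coe_fn_mk, Fin.insertNth_zero', Fin.cons_zero, Fin.cons_succ]
    have hf' : Measurable fun x : Fin n → E => ∏ i, f i.succ (x i) :=
      Finset.measurable_prod _ fun i _ => (hf _).comp (measurable_pi_apply i)
    rw [lintegral_prod_mul (hf 0).aemeasurable hf'.aemeasurable, ih _ _ fun i => hf _]

theorem ae_pi_restrict_mem {n : ℕ} {E : Type*} [MeasureSpace E]
    [SigmaFinite (volume : Measure E)] {U : Fin n → Set E} (hU : ∀ j, MeasurableSet (U j)) :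
    ∀ᵐ x ∂(Measure.pi fun j => (volume : Measure E).restrict (U j)), ∀ j, x j ∈ U j := by
  rw [← Measure.restrict_pi_pi]
  filter_upwards [ae_restrict_mem (MeasurableSet.univ_pi hU)] with x hx j
  exact hx j (Set.mem_univ j)

theorem setLIntegral_rpow_cube_le {k : ℕ} {U : Set (EuclideanSpace ℝ (Fin (k + 1)))}
    {f : EuclideanSpace ℝ (Fin (k + 1)) → ℝ≥0∞} (hf : Measurable f) {δ : ℝ} (hδ : 0 < δ)
    (q : Fin (k + 1) → ℤ) :
    ∫⁻ x in U, {y | cubeIndex δ y = q}.indicator (fun y => f y ^ ((k : ℝ) / (k + 1))) x ≤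
      (∫⁻ x in U, {y | cubeIndex δ y = q}.indicator f x) ^ ((k : ℝ) / (k + 1)) *
        ENNReal.ofReal δ := by
  have hQ : MeasurableSet {y : EuclideanSpace ℝ (Fin (k + 1)) | cubeIndex δ y = q} :=
    measurable_cubeIndex δ (measurableSet_singleton q)
  have hk : (0 : ℝ) < k + 1 := by positivity
  rw [lintegral_indicator hQ, lintegral_indicator hQ]
  have h := ENNReal.lintegral_mul_norm_pow_le
    (μ := (volume.restrict U).restrict {y | cubeIndex δ y = q})
    hf.aemeasurable (measurable_const (a := (1 : ℝ≥0∞))).aemeasurable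
    (p := (k : ℝ) / (k + 1)) (q := 1 / (k + 1)) (by positivity) (by positivity) (by field_simp)
  simp only [ENNReal.one_rpow, mul_one, lintegral_one] at h
  refine h.trans ?_
  gcongr
  rw [one_div, ENNReal.rpow_inv_le_iff hk, Measure.restrict_apply_univ]
  calc _ ≤ volume {y : EuclideanSpace ℝ (Fin (k + 1)) | cubeIndex δ y = q} :=
        Measure.restrict_apply_le _ _
    _ ≤ _ := volume_cubeIndex_eq_le hδ q
    _ = _ := by rw [← ENNReal.rpow_natCast]; push_cast; rfl

theorem lintegral_prod_rpow_indicator_le {k : ℕ}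
    {U : Fin (k + 2) → Set (EuclideanSpace ℝ (Fin (k + 1)))}
    (hUm : ∀ j, MeasurableSet (U j)) (hUb : ∀ j, Bornology.IsBounded (U j))
    {S : Fin (k + 2) → EuclideanSpace ℝ (Fin (k + 1)) → EuclideanSpace ℝ (Fin (k + 2))}
    {L C : ℝ} (hL₀ : 0 ≤ L)
    (hL : ∀ j, ∀ x ∈ U j, ∀ y ∈ U j, ‖S j y - S j x‖ ≤ L * ‖y - x‖)
    (hC : ∀ y y' : Fin (k + 2) → EuclideanSpace ℝ (Fin (k + 1)),
      (∀ j, y j ∈ U j) → (∀ j, y' j ∈ U j) → ∀ t, 0 ≤ t →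
      (∀ m : Fin (k + 1), ‖(S m.castSucc (y' m.castSucc) - S m.castSucc (y m.castSucc)) +
        (S m.succ (y' m.succ) - S m.succ (y m.succ))‖ ≤ t) → ‖y' - y‖ ≤ C * t) :
    ∃ N : ℕ, ∀ f : Fin (k + 2) → EuclideanSpace ℝ (Fin (k + 1)) → ℝ≥0∞,
      (∀ j, Measurable (f j)) → (∀ j, ∫⁻ x in U j, f j x ≠ ∞) → ∀ δ : ℝ, 0 < δ →
      ∀ ξ : EuclideanSpace ℝ (Fin (k + 2)),
      ∫⁻ x, {x : Fin (k + 2) → EuclideanSpace ℝ (Fin (k + 1)) |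
          ‖∑ j, S j (x j) - ξ‖ ≤ δ}.indicator
          (fun x => ∏ j, f j (x j) ^ ((k : ℝ) / (k + 1))) x
          ∂(Measure.pi fun j => volume.restrict (U j)) ≤
        N * ENNReal.ofReal δ ^ (k + 2) * ∏ j, (∫⁻ x in U j, f j x) ^ ((k : ℝ) / (k + 1)) := by
  classical
  set B : ℕ := ⌈C * (2 + ((k + 1 : ℕ) + 1) * (2 * (L * (k + 1 : ℕ))))⌉₊ + 1 with hB
  refine ⟨(2 * B + 1) ^ ((k + 1) * (k + 2)), fun f hf hfin δ hδ ξ => ?_⟩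
  set A : Finset (Fin (k + 1) → ℤ) :=
    Finset.univ.biUnion fun j => ((hUb j).finite_image_cubeIndex δ).toFinset with hA
  let Q (q : Fin (k + 1) → ℤ) : Set (EuclideanSpace ℝ (Fin (k + 1))) := {y | cubeIndex δ y = q}
  have hQ q : MeasurableSet (Q q) := measurable_cubeIndex δ (measurableSet_singleton q)
  let R : Set (Fin (k + 2) → A) := {X | ∃ x : Fin (k + 2) → EuclideanSpace ℝ (Fin (k + 1)),
    (∀ j, x j ∈ U j) ∧ (∀ j, cubeIndex δ (x j) = X j) ∧ ‖∑ j, S j (x j) - ξ‖ ≤ δ}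
  let a (j : Fin (k + 2)) (q : A) : ℝ≥0∞ := ∫⁻ x in U j, (Q q).indicator (f j) x
  have ha_le j (q : A) : a j q ≤ ∫⁻ x in U j, f j x :=
    lintegral_mono fun x => Set.indicator_le_self _ _ x
  have hN (P : Fin (k + 1) → Fin (k + 2) → A) :
      {Y : Fin (k + 2) → A | ∀ m : Fin (k + 1), ∃ X ∈ R, X m.castSucc = Y m.castSucc ∧
        X m.succ = Y m.succ ∧ ∀ j, j ≠ m.castSucc → j ≠ m.succ → X j = P m j}.ncard ≤
      (2 * B + 1) ^ ((k + 1) * (k + 2)) := by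
    have hrep {Y : Fin (k + 2) → A} (hY : ∀ m : Fin (k + 1), ∃ X ∈ R,
        X m.castSucc = Y m.castSucc ∧ X m.succ = Y m.succ ∧
        ∀ j, j ≠ m.castSucc → j ≠ m.succ → X j = P m j) (m : Fin (k + 1)) :
        ∃ x : Fin (k + 2) → EuclideanSpace ℝ (Fin (k + 1)), (∀ j, x j ∈ U j) ∧
        ‖∑ j, S j (x j) - ξ‖ ≤ δ ∧ cubeIndex δ (x m.castSucc) = Y m.castSucc ∧
        cubeIndex δ (x m.succ) = Y m.succ ∧
        ∀ j, j ≠ m.castSucc → j ≠ m.succ → cubeIndex δ (x j) = P m j := by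
      obtain ⟨X, ⟨x, hxU, hxX, hxξ⟩, h1, h2, h3⟩ := hY m
      exact ⟨x, hxU, hxξ, by rw [hxX, h1], by rw [hxX, h2],
        fun j hj hj' => by rw [hxX, h3 j hj hj']⟩
    refine (Set.ncard_le_of_forall_abs_sub_le _ B fun Y hY Y' hY' j i => ?_).trans ?_
    · have h := abs_cubeIndex_sub_le_of_path (Nat.succ_le_succ (Nat.zero_le k)) hL₀ hL hC hδ ξ
        (fun m j => P m j) (Y := fun j => Y j) (Y' := fun j => Y' j) (hrep hY) (hrep hY') j i
      rw [hB]
      push_cast at h ⊢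
      exact h
    · simp
  have hpt : ∀ᵐ x ∂(Measure.pi fun j => volume.restrict (U j)),
      {x : Fin (k + 2) → EuclideanSpace ℝ (Fin (k + 1)) |
          ‖∑ j, S j (x j) - ξ‖ ≤ δ}.indicator
          (fun x => ∏ j, f j (x j) ^ ((k : ℝ) / (k + 1))) x ≤
        ∑ X with X ∈ R, ∏ j, (Q (X j)).indicator (fun y => f j y ^ ((k : ℝ) / (k + 1))) (x j) := by
    filter_upwards [ae_pi_restrict_mem hUm] with x hx
    by_cases hxξ : ‖∑ j, S j (x j) - ξ‖ ≤ δ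
    · have hXA j : cubeIndex δ (x j) ∈ A := by
        simp only [hA, Finset.mem_biUnion, Set.Finite.mem_toFinset]
        exact ⟨j, Finset.mem_univ j, _, hx j, rfl⟩
      let X : Fin (k + 2) → A := fun j => ⟨cubeIndex δ (x j), hXA j⟩
      have hXR : X ∈ Finset.univ.filter (· ∈ R) :=
        Finset.mem_filter.2 ⟨Finset.mem_univ _, x, hx, fun j => rfl, hxξ⟩
      refine le_trans (le_of_eq ?_) (Finset.single_le_sum (fun _ _ => zero_le) hXR)
      rw [Set.indicator_of_mem (by exact hxξ)]
      refine Finset.prod_congr rfl fun j _ => ?_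
      rw [Set.indicator_of_mem]
      exact rfl
    · rw [Set.indicator_of_notMem (by exact hxξ)]
      exact zero_le
  have hmeas j (q : Fin (k + 1) → ℤ) :
      Measurable ((Q q).indicator fun y => f j y ^ ((k : ℝ) / (k + 1))) :=
    ((hf j).pow_const _).indicator (hQ q)
  calc _ ≤ ∫⁻ x, ∑ X with X ∈ R,
          ∏ j, (Q (X j)).indicator (fun y => f j y ^ ((k : ℝ) / (k + 1))) (x j)
          ∂(Measure.pi fun j => volume.restrict (U j)) := lintegral_mono_ae hpt
    _ = ∑ X with X ∈ R, ∏ j, ∫⁻ x in U j,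
          (Q (X j)).indicator (fun y => f j y ^ ((k : ℝ) / (k + 1))) x := by
        rw [lintegral_finsetSum _ fun X _ => Finset.measurable_prod _ fun j _ =>
          (hmeas j (X j)).comp (measurable_pi_apply j)]
        exact Finset.sum_congr rfl fun X _ => lintegral_fin_prod_eq_prod _
          (fun j => (Q (X j)).indicator fun y => f j y ^ ((k : ℝ) / (k + 1)))
          fun j => hmeas j (X j)
    _ ≤ ∑ X with X ∈ R, ∏ j, (a j (X j) ^ ((k : ℝ) / (k + 1)) * ENNReal.ofReal δ) := by
        gcongr
        exact setLIntegral_rpow_cube_le (hf _) hδ _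
    _ = ENNReal.ofReal δ ^ (k + 2) *
          ∑ X with X ∈ R, ∏ j, a j (X j) ^ ((k : ℝ) / (k + 1)) := by
        simp [Finset.prod_mul_distrib, Finset.mul_sum, mul_comm]
    _ ≤ ENNReal.ofReal δ ^ (k + 2) *
          ((((2 * B + 1) ^ ((k + 1) * (k + 2)) : ℕ) : ℝ≥0∞) ^ (1 / ((k : ℝ) + 1)) *
          ∏ j, (∑ q, a j q) ^ ((k : ℝ) / (k + 1))) := by
        gcongr
        exact Finset.sum_prod_rpow_le_of_path_card k R a
          (fun j q => ne_top_of_le_ne_top (hfin j) (ha_le j q)) _ hN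
    _ ≤ ENNReal.ofReal δ ^ (k + 2) * (((2 * B + 1) ^ ((k + 1) * (k + 2)) : ℕ) *
          ∏ j, (∫⁻ x in U j, f j x) ^ ((k : ℝ) / (k + 1))) := by
        gcongr with j
        · refine (ENNReal.rpow_le_rpow_of_exponent_le ?_ ?_).trans (ENNReal.rpow_one _).le
          · exact_mod_cast Nat.one_le_pow _ _ (by positivity)
          · rw [div_le_one (by positivity)]
            linarith [(Nat.cast_nonneg k : (0 : ℝ) ≤ k)]
        · simp only [a]
          rw [← lintegral_finsetSum (f := fun q : A => (Q q).indicator (f j)) _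
            fun q _ => (hf j).indicator (hQ q)]
          refine lintegral_mono fun x => ?_
          by_cases hx : cubeIndex δ x ∈ A
          · rw [Finset.sum_eq_single (⟨_, hx⟩ : A) (fun q _ hq =>
              Set.indicator_of_notMem (fun h => hq (Subtype.ext h.symm)) _) (by simp)]
            exact Set.indicator_le_self _ _ x
          · rw [Finset.sum_eq_zero fun q _ => Set.indicator_of_notMem (fun h => hx ?_) _]
            · exact zero_le
            · have : cubeIndex δ x = q := h
              exact this ▸ q.2
    _ = _ := by ring

theorem integrable_gaussian_mul_cexp_mul {d : ℕ} {Z : Type*} [MeasurableSpace Z]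
    {μ : Measure Z} [SFinite μ] {H : Z → ℂ} (hH : Integrable H μ)
    {Ψ : Z → EuclideanSpace ℝ (Fin d)} (hΨ : Measurable Ψ) {ε : ℝ} (hε : 0 < ε) :
    Integrable (fun p : EuclideanSpace ℝ (Fin d) × Z =>
      cexp (-(ε : ℂ) * ‖p.1‖ ^ 2 + I * ⟪Ψ p.2, p.1⟫_ℝ) * H p.2) (volume.prod μ) := by
  have hG := GaussianFourier.integrable_cexp_neg_mul_sq_norm_add (b := (ε : ℂ)) (by simpa using hε)
    0 (0 : EuclideanSpace ℝ (Fin d))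
  have h := hG.mul_prod hH
  refine h.mono ?_ (Filter.Eventually.of_forall fun p => ?_)
  · refine AEStronglyMeasurable.mul (Measurable.aestronglyMeasurable ?_)
      hH.aestronglyMeasurable.comp_snd
    have : Measurable fun p : EuclideanSpace ℝ (Fin d) × Z => ⟪Ψ p.2, p.1⟫_ℝ :=
      (hΨ.comp measurable_snd).inner measurable_fst
    fun_prop
  · rw [norm_mul, norm_mul, norm_exp, norm_exp]
    simp

theorem lintegral_enorm_sq_mul_gaussian_le {d : ℕ} {X : Type*} [MeasurableSpace X]
    {μ : Measure X} [SFinite μ] {h : X → ℂ} (hh : Integrable h μ)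
    {Φ : X → EuclideanSpace ℝ (Fin d)} (hΦ : Measurable Φ) {ε : ℝ} (hε : 0 < ε) :
    ∫⁻ ξ, ‖∫ x, cexp (I * ⟪ξ, Φ x⟫_ℝ) * h x ∂μ‖ₑ ^ 2 * ENNReal.ofReal (Real.exp (-ε * ‖ξ‖ ^ 2)) ≤
      ∫⁻ z, ‖h z.1‖ₑ * ‖h z.2‖ₑ * ENNReal.ofReal (√(Real.pi / ε) ^ d *
        Real.exp (-‖Φ z.1 - Φ z.2‖ ^ 2 / (4 * ε))) ∂(μ.prod μ) := by
  set F : EuclideanSpace ℝ (Fin d) → ℂ := fun ξ => ∫ x, cexp (I * ⟪ξ, Φ x⟫_ℝ) * h x ∂μ with hF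
  let H : X × X → ℂ := fun z => h z.1 * (starRingEnd ℂ) (h z.2)
  have hH : Integrable H (μ.prod μ) := hh.mul_prod ((conjCLE : ℂ →L[ℝ] ℂ).integrable_comp hh)
  let Ψ : X × X → EuclideanSpace ℝ (Fin d) := fun z => Φ z.1 - Φ z.2
  have hΨ : Measurable Ψ := (hΦ.comp measurable_fst).sub (hΦ.comp measurable_snd)
  have hKint := integrable_gaussian_mul_cexp_mul hH hΨ hε
  have hsq (ξ : EuclideanSpace ℝ (Fin d)) :
      ∫ z, cexp (-(ε : ℂ) * ‖ξ‖ ^ 2 + I * ⟪Ψ z, ξ⟫_ℝ) * H z ∂(μ.prod μ) =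
        ((‖F ξ‖ ^ 2 * Real.exp (-ε * ‖ξ‖ ^ 2) : ℝ) : ℂ) := by
    have hconj : (starRingEnd ℂ) (F ξ) =
        ∫ x, (starRingEnd ℂ) (cexp (I * ⟪ξ, Φ x⟫_ℝ) * h x) ∂μ := integral_conj.symm
    have : ((‖F ξ‖ ^ 2 : ℝ) : ℂ) = F ξ * (starRingEnd ℂ) (F ξ) := by
      rw [Complex.mul_conj, Complex.normSq_eq_norm_sq]
    rw [ofReal_mul, this, hconj, hF, ← integral_prod_mul, ← integral_mul_const]
    refine integral_congr_ae (Filter.Eventually.of_forall fun z => ?_)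
    have hin : ⟪Ψ z, ξ⟫_ℝ = ⟪ξ, Φ z.1⟫_ℝ - ⟪ξ, Φ z.2⟫_ℝ := by
      rw [real_inner_comm, inner_sub_right]
    simp only [map_mul, ← exp_conj, conj_I, conj_ofReal, H, hin, ofReal_exp, exp_add]
    push_cast
    rw [mul_sub, sub_eq_add_neg, exp_add, ← neg_mul]
    ring
  have hpos (ξ : EuclideanSpace ℝ (Fin d)) : 0 ≤ ‖F ξ‖ ^ 2 * Real.exp (-ε * ‖ξ‖ ^ 2) := by
    positivity
  have hFint : Integrable fun ξ => ‖F ξ‖ ^ 2 * Real.exp (-ε * ‖ξ‖ ^ 2) := by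
    have := hKint.integral_prod_left
    simp only [hsq] at this
    exact this.re
  have hval : ((∫ ξ, ‖F ξ‖ ^ 2 * Real.exp (-ε * ‖ξ‖ ^ 2) : ℝ) : ℂ) =
      ∫ z, (Real.pi / (ε : ℂ)) ^ ((d : ℂ) / 2) * cexp (-‖Ψ z‖ ^ 2 / (4 * ε)) * H z ∂(μ.prod μ) := by
    rw [← integral_complex_ofReal]
    simp_rw [← hsq]
    rw [integral_integral_swap hKint]
    refine integral_congr_ae (Filter.Eventually.of_forall fun z => ?_)
    simp only
    rw [integral_mul_const, GaussianFourier.integral_cexp_neg_mul_sq_norm_add (by simpa using hε)]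
    simp
  calc _ = ∫⁻ ξ, ENNReal.ofReal (‖F ξ‖ ^ 2 * Real.exp (-ε * ‖ξ‖ ^ 2)) := by
        refine lintegral_congr fun ξ => ?_
        rw [ENNReal.ofReal_mul (by positivity), ENNReal.ofReal_pow (norm_nonneg _), ofReal_norm]
    _ = ENNReal.ofReal (∫ ξ, ‖F ξ‖ ^ 2 * Real.exp (-ε * ‖ξ‖ ^ 2)) :=
        (ofReal_integral_eq_lintegral_ofReal hFint (Filter.Eventually.of_forall hpos)).symm
    _ = ‖((∫ ξ, ‖F ξ‖ ^ 2 * Real.exp (-ε * ‖ξ‖ ^ 2) : ℝ) : ℂ)‖ₑ := by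
        rw [← ofReal_norm, norm_real, Real.norm_of_nonneg (integral_nonneg hpos)]
    _ ≤ _ := by
        rw [hval]
        refine (enorm_integral_le_lintegral_enorm _).trans (lintegral_mono fun z => le_of_eq ?_)
        have h1 : ‖((Real.pi : ℂ) / (ε : ℂ)) ^ ((d : ℂ) / 2)‖ = √(Real.pi / ε) ^ d := by
          have hp : 0 < Real.pi / ε := by positivity
          rw [← ofReal_div, norm_cpow_eq_rpow_re_of_pos hp, Real.sqrt_eq_rpow,
            ← Real.rpow_mul_natCast hp.le]
          congr 1
          rw [← ofReal_natCast, ← ofReal_ofNat, ← ofReal_div, ofReal_re]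
          ring
        have h2 : ‖cexp (-‖Ψ z‖ ^ 2 / (4 * ε))‖ = Real.exp (-‖Φ z.1 - Φ z.2‖ ^ 2 / (4 * ε)) := by
          have : (-(‖Ψ z‖ : ℂ) ^ 2 / (4 * ε)) = ((-‖Ψ z‖ ^ 2 / (4 * ε) : ℝ) : ℂ) := by push_cast; rfl
          rw [this, norm_exp_ofReal]
        rw [enorm_mul, ← ofReal_norm (_ * _), norm_mul, h1, h2, mul_comm, enorm_mul]
        congr 2
        rw [← ofReal_norm, ← ofReal_norm, RCLike.norm_conj]

theorem exp_neg_sq_div_le_tsum {d : ℕ} {ε : ℝ} (hε : 0 < ε) (s : ℝ) :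
    ENNReal.ofReal (√(Real.pi / ε) ^ d * Real.exp (-s ^ 2 / (4 * ε))) ≤
      ∑' i : ℕ, ENNReal.ofReal (√(Real.pi / ε) ^ d * Real.exp (-i)) *
        {t : ℝ | t ≤ 2 * √(ε * (i + 1))}.indicator 1 s := by
  set i := ⌊s ^ 2 / (4 * ε)⌋₊
  refine le_trans ?_ (ENNReal.le_tsum i)
  rw [Set.indicator_of_mem, Pi.one_apply, mul_one]
  · gcongr
    rw [neg_div, neg_le_neg_iff]
    exact Nat.floor_le (by positivity)
  · have h1 := Nat.lt_floor_add_one (s ^ 2 / (4 * ε))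
    rw [div_lt_iff₀ (by positivity)] at h1
    have h2 : s ≤ √(4 * (ε * (i + 1))) := Real.le_sqrt_of_sq_le (by linarith)
    rwa [Real.sqrt_mul (by norm_num), show (4 : ℝ) = 2 ^ 2 by norm_num,
      Real.sqrt_sq (by norm_num)] at h2

theorem exists_lintegral_enorm_sq_le (d : ℕ) (X : Type*) [MeasurableSpace X] :
    ∃ C : ℝ≥0∞, C ≠ ∞ ∧ ∀ (μ : Measure X) [SFinite μ] (h : X → ℂ), Measurable h →
      Integrable h μ → ∀ Φ : X → EuclideanSpace ℝ (Fin d), Measurable Φ → ∀ M : ℝ≥0∞,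
      (∀ δ : ℝ, 0 < δ → ∫⁻ z, {z : X × X | ‖Φ z.1 - Φ z.2‖ ≤ δ}.indicator
        (fun z => ‖h z.1‖ₑ * ‖h z.2‖ₑ) z ∂(μ.prod μ) ≤ M * ENNReal.ofReal δ ^ d) →
      ∫⁻ ξ, ‖∫ x, cexp (I * ⟪ξ, Φ x⟫_ℝ) * h x ∂μ‖ₑ ^ 2 ≤ C * M := by
  have hsum : Summable fun i : ℕ => (2 * √Real.pi) ^ d * (Real.exp (-i) * (i + 1) ^ d) := by
    have h1 := (Real.summable_pow_mul_exp_neg_nat_mul d one_pos)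
    rw [← summable_nat_add_iff 1] at h1
    refine (h1.mul_left ((2 * √Real.pi) ^ d * Real.exp 1)).congr fun i => ?_
    push_cast
    rw [show -1 * ((i : ℝ) + 1) = -i + -1 by ring, Real.exp_add, Real.exp_neg 1]
    field_simp
  refine ⟨_, hsum.tsum_ofReal_ne_top, fun μ _ h hhm hh Φ hΦ M hM => ?_⟩
  set F : EuclideanSpace ℝ (Fin d) → ℂ := fun ξ => ∫ x, cexp (I * ⟪ξ, Φ x⟫_ℝ) * h x ∂μ with hF
  have hFc : Continuous F := by
    refine continuous_of_dominated (bound := fun x => ‖h x‖) (fun ξ => ?_) (fun ξ => ?_) hh.norm ?_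
    · have : Measurable fun x => ⟪ξ, Φ x⟫_ℝ := measurable_const.inner hΦ
      exact Measurable.aestronglyMeasurable (by fun_prop)
    · refine Filter.Eventually.of_forall fun x => ?_
      rw [norm_mul, mul_comm I, norm_exp_ofReal_mul_I, one_mul]
    · exact Filter.Eventually.of_forall fun x => by fun_prop
  have hdist : Measurable fun z : X × X => ‖Φ z.1 - Φ z.2‖ :=
    ((hΦ.comp measurable_fst).sub (hΦ.comp measurable_snd)).norm
  have hε (ε : ℝ) (hε : 0 < ε) :
      ∫⁻ ξ, ‖F ξ‖ₑ ^ 2 * ENNReal.ofReal (Real.exp (-ε * ‖ξ‖ ^ 2)) ≤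
        (∑' i : ℕ, ENNReal.ofReal ((2 * √Real.pi) ^ d * (Real.exp (-i) * (i + 1) ^ d))) * M := by
    calc _ ≤ ∫⁻ z, ‖h z.1‖ₑ * ‖h z.2‖ₑ * ENNReal.ofReal (√(Real.pi / ε) ^ d *
          Real.exp (-‖Φ z.1 - Φ z.2‖ ^ 2 / (4 * ε))) ∂(μ.prod μ) :=
          lintegral_enorm_sq_mul_gaussian_le hh hΦ hε
      _ ≤ ∫⁻ z, ∑' i : ℕ, ENNReal.ofReal (√(Real.pi / ε) ^ d * Real.exp (-i)) *
          {z : X × X | ‖Φ z.1 - Φ z.2‖ ≤ 2 * √(ε * (i + 1))}.indicator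
            (fun z => ‖h z.1‖ₑ * ‖h z.2‖ₑ) z ∂(μ.prod μ) := by
          refine lintegral_mono fun z => ?_
          grw [exp_neg_sq_div_le_tsum hε, ← ENNReal.tsum_mul_left]
          refine ENNReal.tsum_le_tsum fun i => ?_
          by_cases hz : ‖Φ z.1 - Φ z.2‖ ≤ 2 * √(ε * (i + 1))
          · rw [Set.indicator_of_mem (by exact hz), Set.indicator_of_mem (by exact hz)]
            simp [mul_comm]
          · rw [Set.indicator_of_notMem (by exact hz)]
            simp
      _ = ∑' i : ℕ, ENNReal.ofReal (√(Real.pi / ε) ^ d * Real.exp (-i)) *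
          ∫⁻ z, {z : X × X | ‖Φ z.1 - Φ z.2‖ ≤ 2 * √(ε * (i + 1))}.indicator
            (fun z => ‖h z.1‖ₑ * ‖h z.2‖ₑ) z ∂(μ.prod μ) := by
          have hmeas (i : ℕ) : Measurable
              ({z : X × X | ‖Φ z.1 - Φ z.2‖ ≤ 2 * √(ε * (i + 1))}.indicator
                fun z => ‖h z.1‖ₑ * ‖h z.2‖ₑ) :=
            ((hhm.comp measurable_fst).enorm.mul (hhm.comp measurable_snd).enorm).indicator
              (hdist measurableSet_Iic)
          rw [lintegral_tsum fun i => ((hmeas i).const_mul _).aemeasurable]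
          exact tsum_congr fun i => lintegral_const_mul _ (hmeas i)
      _ ≤ ∑' i : ℕ, ENNReal.ofReal (√(Real.pi / ε) ^ d * Real.exp (-i)) *
          (M * ENNReal.ofReal (2 * √(ε * (i + 1))) ^ d) := by
          gcongr with i
          exact hM _ (by positivity)
      _ ≤ _ := by
          rw [← ENNReal.tsum_mul_right]
          refine ENNReal.tsum_le_tsum fun i => ?_
          rw [mul_comm M, ← mul_assoc, ← ENNReal.ofReal_pow (by positivity),
            ← ENNReal.ofReal_mul (by positivity)]
          gcongr ENNReal.ofReal ?_ * M
          have h1 : √(Real.pi / ε) * (2 * √(ε * (i + 1))) = 2 * √Real.pi * √(i + 1) := by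
            rw [Real.sqrt_div' _ hε.le, Real.sqrt_mul hε.le]
            have : √ε ≠ 0 := by positivity
            field_simp
          calc _ = (√(Real.pi / ε) * (2 * √(ε * (i + 1)))) ^ d * Real.exp (-i) := by
                rw [mul_pow]; ring
            _ = (2 * √Real.pi) ^ d * (Real.exp (-i) * √(i + 1) ^ d) := by
                rw [h1, mul_pow]; ring
            _ ≤ _ := by
                gcongr
                exact (Real.sqrt_le_left (by positivity)).2
                  (by nlinarith [(Nat.cast_nonneg i : (0 : ℝ) ≤ i)])
  have hmeas (m : ℕ) : Measurable fun ξ : EuclideanSpace ℝ (Fin d) =>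
      ‖F ξ‖ₑ ^ 2 * ENNReal.ofReal (Real.exp (-(1 / ((m : ℝ) + 1)) * ‖ξ‖ ^ 2)) := by
    have := hFc.measurable
    fun_prop
  have hlim (ξ : EuclideanSpace ℝ (Fin d)) : Filter.Tendsto (fun m : ℕ =>
      ‖F ξ‖ₑ ^ 2 * ENNReal.ofReal (Real.exp (-(1 / ((m : ℝ) + 1)) * ‖ξ‖ ^ 2)))
      Filter.atTop (nhds (‖F ξ‖ₑ ^ 2)) := by
    have h0 : Filter.Tendsto (fun m : ℕ => Real.exp (-(1 / ((m : ℝ) + 1)) * ‖ξ‖ ^ 2))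
        Filter.atTop (nhds 1) := by
      have := ((tendsto_one_div_add_atTop_nhds_zero_nat (𝕜 := ℝ)).neg.mul_const (‖ξ‖ ^ 2)).rexp
      simpa using this
    have := ENNReal.Tendsto.const_mul (a := ‖F ξ‖ₑ ^ 2) (ENNReal.tendsto_ofReal h0)
      (Or.inl (by simp))
    simpa using this
  calc ∫⁻ ξ, ‖F ξ‖ₑ ^ 2 = ∫⁻ ξ, Filter.liminf (fun m : ℕ =>
        ‖F ξ‖ₑ ^ 2 * ENNReal.ofReal (Real.exp (-(1 / ((m : ℝ) + 1)) * ‖ξ‖ ^ 2))) Filter.atTop :=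
        lintegral_congr fun ξ => (hlim ξ).liminf_eq.symm
    _ ≤ _ := lintegral_liminf_le hmeas
    _ ≤ _ := Filter.liminf_le_of_le (by isBoundedDefault) fun b hb => by
        obtain ⟨m, hm⟩ := hb.exists
        exact hm.trans (hε _ (by positivity))

theorem ENNReal.mul_rpow_half_le_add (s t : ℝ≥0∞) :
    s ^ (1 / 2 : ℝ) * t ^ (1 / 2 : ℝ) ≤ s + t := by
  have h (u : ℝ≥0∞) : u ^ (1 / 2 : ℝ) * u ^ (1 / 2 : ℝ) = u := by
    rw [← ENNReal.rpow_add_of_nonneg _ _ (by norm_num) (by norm_num)]; norm_num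
  rcases le_total s t with hst | hst
  · calc _ ≤ t ^ (1 / 2 : ℝ) * t ^ (1 / 2 : ℝ) := by gcongr
      _ ≤ _ := (h t).le.trans le_add_self
  · calc _ ≤ s ^ (1 / 2 : ℝ) * s ^ (1 / 2 : ℝ) := by gcongr
      _ ≤ _ := (h s).le.trans le_self_add

theorem lintegral_prod_indicator_le_two_mul {d : ℕ} {X : Type*} [MeasurableSpace X]
    {μ : Measure X} [SFinite μ] {A B : X → ℝ≥0∞} (hA : Measurable A) (hB : Measurable B)
    {Φ : X → EuclideanSpace ℝ (Fin d)} (hΦ : Measurable Φ) {δ : ℝ} {M : ℝ≥0∞}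
    (hM : ∀ ξ, ∫⁻ x, {x | ‖Φ x - ξ‖ ≤ δ}.indicator B x ∂μ ≤ M) :
    ∫⁻ z, {z : X × X | ‖Φ z.1 - Φ z.2‖ ≤ δ}.indicator
      (fun z => (A z.1 * B z.1) ^ (1 / 2 : ℝ) * (A z.2 * B z.2) ^ (1 / 2 : ℝ)) z ∂(μ.prod μ) ≤
      2 * ((∫⁻ x, A x ∂μ) * M) := by
  set D : Set (X × X) := {z | ‖Φ z.1 - Φ z.2‖ ≤ δ}
  have hD : MeasurableSet D :=
    ((hΦ.comp measurable_fst).sub (hΦ.comp measurable_snd)).norm measurableSet_Iic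
  have h1 : Measurable (D.indicator fun z => A z.1 * B z.2) :=
    ((hA.comp measurable_fst).mul (hB.comp measurable_snd)).indicator hD
  have h2 : Measurable (D.indicator fun z => A z.2 * B z.1) :=
    ((hA.comp measurable_snd).mul (hB.comp measurable_fst)).indicator hD
  calc _ ≤ ∫⁻ z, (D.indicator (fun z => A z.1 * B z.2) z +
        D.indicator (fun z => A z.2 * B z.1) z) ∂(μ.prod μ) := by
        refine lintegral_mono fun z => ?_
        refine (Set.indicator_le_indicator ?_).trans (congrFun (Set.indicator_add D _ _) z).le
        calc _ = (A z.1 * B z.2) ^ (1 / 2 : ℝ) * (A z.2 * B z.1) ^ (1 / 2 : ℝ) := by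
              rw [← ENNReal.mul_rpow_of_nonneg _ _ (by norm_num),
                ← ENNReal.mul_rpow_of_nonneg _ _ (by norm_num)]
              congr 1
              ring
          _ ≤ _ := ENNReal.mul_rpow_half_le_add _ _
    _ = (∫⁻ x, ∫⁻ y, D.indicator (fun z => A z.1 * B z.2) (x, y) ∂μ ∂μ) +
        ∫⁻ y, ∫⁻ x, D.indicator (fun z => A z.2 * B z.1) (x, y) ∂μ ∂μ := by
        rw [lintegral_add_left h1, lintegral_prod _ h1.aemeasurable,
          lintegral_prod_symm _ h2.aemeasurable]
    _ ≤ (∫⁻ x, A x * M ∂μ) + ∫⁻ y, A y * M ∂μ := by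
        have hB' (ξ : EuclideanSpace ℝ (Fin d)) :
            Measurable ({x | ‖Φ x - ξ‖ ≤ δ}.indicator B) :=
          hB.indicator ((hΦ.sub_const ξ).norm measurableSet_Iic)
        gcongr with x y
        · refine le_trans (le_of_eq ?_) (mul_le_mul_right (hM (Φ x)) (A x))
          rw [← lintegral_const_mul _ (hB' _)]
          refine lintegral_congr fun y => ?_
          simp only [Set.indicator_apply, D, mul_ite, mul_zero]
          exact if_congr (Iff.of_eq (congrArg (· ≤ δ) (norm_sub_rev _ _))) rfl rfl
        · refine le_trans (le_of_eq ?_) (mul_le_mul_right (hM (Φ y)) (A y))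
          rw [← lintegral_const_mul _ (hB' _)]
          refine lintegral_congr fun x => ?_
          simp only [Set.indicator_apply, D, mul_ite, mul_zero]
          rfl
    _ = _ := by rw [lintegral_mul_const _ hA, two_mul]

theorem extOp_congr_ae {n : ℕ} {U : Set (EuclideanSpace ℝ (Fin n))}
    (S : EuclideanSpace ℝ (Fin n) → EuclideanSpace ℝ (Fin (n + 1)))
    {g g' : EuclideanSpace ℝ (Fin n) → ℂ} (h : g =ᵐ[volume.restrict U] g') :
    extOp U S g = extOp U S g' :=
  funext fun _ => integral_congr_ae (h.mono fun x hx => by simp only [hx])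

theorem extOp_eq_zero_of_not_aestronglyMeasurable {n : ℕ} {U : Set (EuclideanSpace ℝ (Fin n))}
    {S : EuclideanSpace ℝ (Fin n) → EuclideanSpace ℝ (Fin (n + 1))} (hS : Measurable S)
    {g : EuclideanSpace ℝ (Fin n) → ℂ} (h : ¬ AEStronglyMeasurable g (volume.restrict U)) :
    extOp U S g = 0 := by
  refine funext fun ξ => integral_non_aestronglyMeasurable fun h' => h ?_
  have hm : Measurable fun x => ⟪ξ, S x⟫_ℝ := measurable_const.inner hS
  have he : AEStronglyMeasurable (fun x => cexp (-(I * ⟪ξ, S x⟫_ℝ))) (volume.restrict U) :=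
    Measurable.aestronglyMeasurable (by fun_prop)
  refine (he.mul h').congr (Filter.Eventually.of_forall fun x => ?_)
  rw [Pi.mul_apply, ← mul_assoc, ← Complex.exp_add, neg_add_cancel, Complex.exp_zero, one_mul]

theorem prod_extOp_eq_integral {n : ℕ} (U : Fin (n + 1) → Set (EuclideanSpace ℝ (Fin n)))
    (S : Fin (n + 1) → EuclideanSpace ℝ (Fin n) → EuclideanSpace ℝ (Fin (n + 1)))
    (g : Fin (n + 1) → EuclideanSpace ℝ (Fin n) → ℂ) (ξ : EuclideanSpace ℝ (Fin (n + 1))) :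
    ∏ j, extOp (U j) (S j) (g j) ξ =
      ∫ x, cexp (I * ⟪ξ, ∑ j, S j (x j)⟫_ℝ) * ∏ j, g j (x j)
        ∂(Measure.pi fun j => volume.restrict (U j)) := by
  simp only [extOp]
  rw [← integral_fintype_prod_eq_prod]
  simp [Finset.prod_mul_distrib, inner_sum, Finset.mul_sum, Complex.exp_sum]

theorem eLpNorm_prod_extOp_le_of_measurable {k : ℕ}
    {U : Fin (k + 2) → Set (EuclideanSpace ℝ (Fin (k + 1)))} (hU : ∀ j, IsCompact (U j))
    {S : Fin (k + 2) → EuclideanSpace ℝ (Fin (k + 1)) → EuclideanSpace ℝ (Fin (k + 2))}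
    (hS : ∀ j, Measurable (S j)) {L C : ℝ} (hL₀ : 0 ≤ L)
    (hL : ∀ j, ∀ x ∈ U j, ∀ y ∈ U j, ‖S j y - S j x‖ ≤ L * ‖y - x‖)
    (hC : ∀ y y' : Fin (k + 2) → EuclideanSpace ℝ (Fin (k + 1)),
      (∀ j, y j ∈ U j) → (∀ j, y' j ∈ U j) → ∀ t, 0 ≤ t →
      (∀ m : Fin (k + 1), ‖(S m.castSucc (y' m.castSucc) - S m.castSucc (y m.castSucc)) +
        (S m.succ (y' m.succ) - S m.succ (y m.succ))‖ ≤ t) → ‖y' - y‖ ≤ C * t)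
    {p : ℝ} (hp : p = (2 * k + 2) / (2 * k + 1)) :
    ∃ c : ℝ≥0∞, c ≠ ∞ ∧ ∀ g : Fin (k + 2) → EuclideanSpace ℝ (Fin (k + 1)) → ℂ,
      (∀ j, Measurable (g j)) →
      (∀ j, MemLp (g j) (ENNReal.ofReal p) (volume.restrict (U j))) →
      eLpNorm (fun ξ => ∏ j, extOp (U j) (S j) (g j) ξ) 2 volume ≤
        c * ∏ j, eLpNorm (g j) (ENNReal.ofReal p) (volume.restrict (U j)) := by
  have hk : (0 : ℝ) ≤ k := Nat.cast_nonneg k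
  have hp1 : 1 ≤ p := by rw [hp, one_le_div (by positivity)]; linarith
  have hp0 : 0 < p := one_pos.trans_le hp1
  obtain ⟨N, hN⟩ := lintegral_prod_rpow_indicator_le (fun j => (hU j).measurableSet)
    (fun j => (hU j).isBounded) hL₀ hL hC
  obtain ⟨c, hc, hcM⟩ := exists_lintegral_enorm_sq_le (k + 2)
    (Fin (k + 2) → EuclideanSpace ℝ (Fin (k + 1)))
  refine ⟨(c * (2 * N)) ^ (1 / 2 : ℝ), ENNReal.rpow_ne_top_of_nonneg (by norm_num)
    (ENNReal.mul_ne_top hc (ENNReal.mul_ne_top (by simp) (by simp))), fun g hg hgp => ?_⟩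
  have hnorm (j : Fin (k + 2)) : eLpNorm (g j) (ENNReal.ofReal p) (volume.restrict (U j)) =
      (∫⁻ x in U j, ‖g j x‖ₑ ^ p) ^ (1 / p) := by
    rw [eLpNorm_eq_lintegral_rpow_enorm_toReal (by simpa using hp0) ENNReal.ofReal_ne_top,
      ENNReal.toReal_ofReal hp0.le]
  let f (j : Fin (k + 2)) (x : EuclideanSpace ℝ (Fin (k + 1))) : ℝ≥0∞ := ‖g j x‖ₑ ^ p
  have hf j : Measurable (f j) := (hg j).enorm.pow_const p
  have hfin j : ∫⁻ x in U j, f j x ≠ ∞ := by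
    have := (hgp j).eLpNorm_ne_top
    rw [hnorm, Ne, ENNReal.rpow_eq_top_iff_of_pos (by positivity)] at this
    exact this
  let A (x : Fin (k + 2) → EuclideanSpace ℝ (Fin (k + 1))) : ℝ≥0∞ := ∏ j, f j (x j)
  let B (x : Fin (k + 2) → EuclideanSpace ℝ (Fin (k + 1))) : ℝ≥0∞ :=
    ∏ j, f j (x j) ^ ((k : ℝ) / (k + 1))
  have hA : Measurable A :=
    Finset.measurable_prod _ fun j _ => (hf j).comp (measurable_pi_apply j)
  have hB : Measurable B :=
    Finset.measurable_prod _ fun j _ => ((hf j).comp (measurable_pi_apply j)).pow_const _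
  have hAB (x : Fin (k + 2) → EuclideanSpace ℝ (Fin (k + 1))) :
      ‖∏ j, g j (x j)‖ₑ = (A x * B x) ^ (1 / 2 : ℝ) := by
    have hprod : ‖∏ j, g j (x j)‖ₑ = ∏ j, ‖g j (x j)‖ₑ := by
      simp only [← ofReal_norm, norm_prod]
      exact ENNReal.ofReal_prod_of_nonneg fun j _ => norm_nonneg _
    simp only [A, B, f]
    rw [← Finset.prod_mul_distrib, ← ENNReal.prod_rpow_of_nonneg (by norm_num), hprod]
    refine Finset.prod_congr rfl fun j _ => ?_
    rw [← ENNReal.rpow_mul, ← ENNReal.rpow_add_of_nonneg _ _ hp0.le (by positivity),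
      ← ENNReal.rpow_mul]
    convert (ENNReal.rpow_one _).symm using 2
    rw [hp]
    field_simp
    ring
  have hΦ : Measurable fun x : Fin (k + 2) → EuclideanSpace ℝ (Fin (k + 1)) =>
      ∑ j, S j (x j) :=
    Finset.measurable_sum _ fun j _ => (hS j).comp (measurable_pi_apply j)
  have hgm : Measurable fun x : Fin (k + 2) → EuclideanSpace ℝ (Fin (k + 1)) => ∏ j, g j (x j) :=
    Finset.measurable_prod _ fun j _ => (hg j).comp (measurable_pi_apply j)
  have hgi : Integrable (fun x : Fin (k + 2) → EuclideanSpace ℝ (Fin (k + 1)) => ∏ j, g j (x j))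
      (Measure.pi fun j => volume.restrict (U j)) := by
    refine Integrable.fintype_prod fun j => ?_
    have : IsFiniteMeasure (volume.restrict (U j)) := ⟨by simpa using (hU j).measure_lt_top⟩
    exact (hgp j).integrable (by simpa using hp1)
  have hkey := hcM (Measure.pi fun j => volume.restrict (U j)) (fun x => ∏ j, g j (x j)) hgm hgi
    (fun x => ∑ j, S j (x j)) hΦ
    (2 * N * ∏ j, (∫⁻ x in U j, f j x) * (∫⁻ x in U j, f j x) ^ ((k : ℝ) / (k + 1))) ?_
  · have h2 : eLpNorm (fun ξ => ∏ j, extOp (U j) (S j) (g j) ξ) 2 volume =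
        (∫⁻ ξ, ‖∏ j, extOp (U j) (S j) (g j) ξ‖ₑ ^ 2) ^ (1 / 2 : ℝ) := by
      rw [eLpNorm_eq_lintegral_rpow_enorm_toReal (by simp) (by simp)]
      simp
    simp_rw [← prod_extOp_eq_integral] at hkey
    rw [h2]
    grw [hkey]
    rw [← mul_assoc, ENNReal.mul_rpow_of_nonneg _ _ (by norm_num),
      ← ENNReal.prod_rpow_of_nonneg (by norm_num)]
    refine le_of_eq (congrArg _ (Finset.prod_congr rfl fun j _ => ?_))
    rw [hnorm]
    set T := ∫⁻ x in U j, f j x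
    conv_lhs => rw [← ENNReal.rpow_one T, ← ENNReal.rpow_mul,
      ← ENNReal.rpow_add_of_nonneg _ _ zero_le_one (by positivity), ← ENNReal.rpow_mul]
    congr 1
    rw [hp]
    field_simp
    ring
  · intro δ hδ
    simp only [hAB]
    refine (lintegral_prod_indicator_le_two_mul hA hB hΦ (hN f hf hfin δ hδ)).trans (le_of_eq ?_)
    rw [lintegral_fin_prod_eq_prod _ f hf, Finset.prod_mul_distrib]
    ring

/-- The sharp global `d`-linear restriction estimate at `L²` (`d = n+1 ≥ 2`): for `d`
transversal smooth parametrised hypersurfaces there exists `r > 0` such that whenever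
the (compact) domains `U_j` have diameter at most `r`, there is a finite constant `C`
with `‖∏_j E_j g_j‖_{L²(ℝ^d)} ≤ C ∏_j ‖g_j‖_{L^{(2d-2)'}(U_j)}`, where
`(2d−2)' = (2d−2)/(2d−3)`.  Unlike the near-optimal `d`-linear restriction theorem this
carries no `R^ε` or logarithmic loss. -/
theorem sharp_global_multilinear_restriction (n : ℕ) (hn : 1 ≤ n)
    (ν₀ : ℝ) (hν₀ : 0 < ν₀)
    (K : Fin (n + 1) → Set (EuclideanSpace ℝ (Fin n))) (hK : ∀ j, IsCompact (K j))
    (S : Fin (n + 1) → EuclideanSpace ℝ (Fin n) → EuclideanSpace ℝ (Fin (n + 1)))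
    (hS : ∀ j, ContDiff ℝ (⊤ : ℕ∞) (S j))
    (hSimm : ∀ j, ∀ x ∈ K j, Function.Injective (fderiv ℝ (S j) x))
    (ν : Fin (n + 1) → EuclideanSpace ℝ (Fin n) → EuclideanSpace ℝ (Fin (n + 1)))
    (hνunit : ∀ j, ∀ x ∈ K j, ‖ν j x‖ = 1)
    (hνperp : ∀ j, ∀ x ∈ K j, ∀ v, ⟪ν j x, fderiv ℝ (S j) x v⟫_ℝ = 0)
    (htrans : ∀ x : (j : Fin (n + 1)) → EuclideanSpace ℝ (Fin n),
      (∀ j, x j ∈ K j) →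
      ν₀ ≤ |Matrix.det (Matrix.of fun i j => ν j (x j) i)|) :
    ∃ r > 0, ∀ U : Fin (n + 1) → Set (EuclideanSpace ℝ (Fin n)),
      (∀ j, IsCompact (U j) ∧ U j ⊆ K j ∧ Metric.diam (U j) ≤ r) →
      ∃ C > 0, ∀ g : (j : Fin (n + 1)) → EuclideanSpace ℝ (Fin n) → ℂ,
        eLpNorm (fun ξ => ∏ j, extOp (U j) (S j) (g j) ξ) 2 volume
          ≤ ENNReal.ofReal C *
            ∏ j, eLpNorm (g j)
              (ENNReal.ofReal ((2 * (n : ℝ)) / (2 * (n : ℝ) - 1)))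
              (volume.restrict (U j)) := by
  obtain ⟨k, rfl⟩ : ∃ k, n = k + 1 := ⟨n - 1, by omega⟩
  obtain ⟨r, hr, C, hC, L, hL, hLip, hgeo⟩ := exists_norm_sub_le_of_transversal (k + 1) hν₀ K hK S
    (fun j => (hS j).of_le (by exact_mod_cast le_top)) hSimm ν hνunit hνperp htrans
  refine ⟨r, hr, fun U hU => ?_⟩
  have hdist j {x y : EuclideanSpace ℝ (Fin (k + 1))} (hx : x ∈ U j) (hy : y ∈ U j) :
      dist x y ≤ r :=
    (dist_le_diam_of_mem (hU j).1.isBounded hx hy).trans (hU j).2.2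
  have hSm j : Measurable (S j) := (hS j).continuous.measurable
  set p : ℝ := (2 * ((k + 1 : ℕ) : ℝ)) / (2 * ((k + 1 : ℕ) : ℝ) - 1) with hp
  have hp0 : 0 < p := by
    rw [hp]; push_cast
    exact div_pos (by positivity) (by linarith [(Nat.cast_nonneg k : (0 : ℝ) ≤ k)])
  obtain ⟨c, hc, hbound⟩ := eLpNorm_prod_extOp_le_of_measurable (fun j => (hU j).1) hSm hL.le
    (fun j x hx y hy => hLip j x ((hU j).2.1 hx) y (hdist j hx hy))
    (fun y y' hy hy' => hgeo y y' (fun j => (hU j).2.1 (hy j)) fun j => hdist j (hy j) (hy' j))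
    (p := p) (by rw [hp]; push_cast; congr 1 <;> ring)
  refine ⟨c.toReal + 1, by positivity, fun g => ?_⟩
  by_cases h0 : ∃ j, extOp (U j) (S j) (g j) = 0
  · obtain ⟨j, hj⟩ := h0
    have : (fun ξ => ∏ j, extOp (U j) (S j) (g j) ξ) = 0 :=
      funext fun ξ => Finset.prod_eq_zero (Finset.mem_univ j) (congrFun hj ξ)
    rw [this, eLpNorm_zero]
    exact zero_le
  push Not at h0
  have hmeas j : AEStronglyMeasurable (g j) (volume.restrict (U j)) := by
    by_contra h
    exact h0 j (extOp_eq_zero_of_not_aestronglyMeasurable (hSm j) h)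
  have hne j : eLpNorm (g j) (ENNReal.ofReal p) (volume.restrict (U j)) ≠ 0 := by
    intro h
    rw [eLpNorm_eq_zero_iff (hmeas j) (by simpa using hp0)] at h
    refine h0 j ((extOp_congr_ae (S j) h).trans (funext fun ξ => ?_))
    simp [extOp]
  by_cases htop : ∃ j, eLpNorm (g j) (ENNReal.ofReal p) (volume.restrict (U j)) = ∞
  · obtain ⟨j, hj⟩ := htop
    rw [← Finset.mul_prod_erase _ _ (Finset.mem_univ j), hj, ENNReal.top_mul, ENNReal.mul_top]
    · exact le_top
    · rw [Ne, ENNReal.ofReal_eq_zero, not_le]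
      positivity
    · exact Finset.prod_ne_zero_iff.2 fun i _ => hne i
  push Not at htop
  have hae j := (hmeas j).ae_eq_mk
  have hmem j : MemLp ((hmeas j).mk (g j)) (ENNReal.ofReal p) (volume.restrict (U j)) :=
    MemLp.ae_eq (hae j) ⟨hmeas j, (htop j).lt_top⟩
  have h := hbound (fun j => (hmeas j).mk (g j))
    (fun j => (hmeas j).stronglyMeasurable_mk.measurable) hmem
  simp_rw [← extOp_congr_ae (S _) (hae _), ← eLpNorm_congr_ae (hae _)] at h
  refine h.trans ?_
  gcongr
  exact ENNReal.le_ofReal_iff_toReal_le hc (by positivity) |>.2 (by linarith)
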